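/- arXiv:2212.02393 — 3 statements merged into one kernel-verified Lean document; each statement's English description precedes it below -/
import Mathlib

section
/- Let n ≥ 3. For any compact totally disconnected set K ⊆ ℝⁿ and any point x ∈ K, the following are equivalent: (a) K is locally wild at x; (b) K is not locally hyperplanar at x. -/
open Set Topology Metric

noncomputable section

/-- The coordinate line `ℝ × {0}^{n-1}` in `ℝⁿ`. -/
def coordLine (n : ℕ) : Set (EuclideanSpace ℝ (Fin n)) :=
  {x | ∀ i : Fin n, (i : ℕ) ≠ 0 → x i = 0}

/-- The coordinate hyperplane `ℝ^{n-1} × {0}` in `ℝⁿ`. -/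
def coordHyperplane (n : ℕ) : Set (EuclideanSpace ℝ (Fin n)) :=
  {x | ∀ i : Fin n, (i : ℕ) = n - 1 → x i = 0}

/-- `X` can be ambiently embedded in `Y`: some self-homeomorphism of `ℝⁿ` takes `X` into `Y`. -/
def AmbientlyEmbeds {n : ℕ} (X Y : Set (EuclideanSpace ℝ (Fin n))) : Prop :=
  ∃ h : EuclideanSpace ℝ (Fin n) ≃ₜ EuclideanSpace ℝ (Fin n), h '' X ⊆ Y

/-- `X` and `Y` are ambiently incomparable. -/
def AmbientlyIncomparable {n : ℕ} (X Y : Set (EuclideanSpace ℝ (Fin n))) : Prop :=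
  ¬ AmbientlyEmbeds X Y ∧ ¬ AmbientlyEmbeds Y X

/-- `X ⊆ ℝⁿ` is locally hyperplanar at `x ∈ X`. -/
def LocallyHyperplanarAt {n : ℕ} (X : Set (EuclideanSpace ℝ (Fin n)))
    (x : EuclideanSpace ℝ (Fin n)) : Prop :=
  ∃ U ∈ 𝓝 x, ∃ h : U → EuclideanSpace ℝ (Fin n), Topology.IsEmbedding h ∧
    ∀ y : U, (y : EuclideanSpace ℝ (Fin n)) ∈ X → h y ∈ coordHyperplane n

/-- A compact zero-dimensional set `K ⊆ ℝⁿ` is tame if a self-homeomorphism of `ℝⁿ`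
moves it into the coordinate line. -/
def TameSet {n : ℕ} (K : Set (EuclideanSpace ℝ (Fin n))) : Prop :=
  ∃ h : EuclideanSpace ℝ (Fin n) ≃ₜ EuclideanSpace ℝ (Fin n), h '' K ⊆ coordLine n

/-- `K` is locally tame at `x`. -/
def LocallyTameAt {n : ℕ} (K : Set (EuclideanSpace ℝ (Fin n)))
    (x : EuclideanSpace ℝ (Fin n)) : Prop :=
  ∃ U ∈ 𝓝 x, TameSet (K ∩ closure U)

/-- `K` is everywhere wild: locally wild at each of its points. -/
def EverywhereWild {n : ℕ} (K : Set (EuclideanSpace ℝ (Fin n))) : Prop :=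
  ∀ x ∈ K, ¬ LocallyTameAt K x

/-- `K` is a Cantor set: homeomorphic to the middle-thirds Cantor set. -/
def IsCantorSet {X : Type*} [TopologicalSpace X] (K : Set X) : Prop :=
  Nonempty (↥K ≃ₜ ↥cantorSet)

/-- The unit cube `Iⁿ = [0,1]ⁿ` in `ℝⁿ`. -/
def unitCube (n : ℕ) : Set (EuclideanSpace ℝ (Fin n)) :=
  {x | ∀ i, x i ∈ Set.Icc (0 : ℝ) 1}

/-- The open face `(0,1)^{n-1} × {0}` of the unit cube. -/
def openFace (n : ℕ) : Set (EuclideanSpace ℝ (Fin n)) :=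
  {x | (∀ i : Fin n, (i : ℕ) < n - 1 → x i ∈ Set.Ioo (0 : ℝ) 1) ∧
    ∀ i : Fin n, (i : ℕ) = n - 1 → x i = 0}

section Brouwer

open MeasureTheory

/-- The interpolation coefficients `c` depend only on the dimension and the step `τ`. -/
theorem LinearMap.exists_det_one_add_eq_sum {E : Type*} [AddCommGroup E] [Module ℝ E]
    [FiniteDimensional ℝ E] {τ : ℝ} (hτ : τ ≠ 0) :
    ∃ c : ℕ → ℝ, ∑ j ∈ Finset.range (Module.finrank ℝ E + 1), c j = 1 ∧
      ∀ A : E →ₗ[ℝ] E, LinearMap.det (1 + A) =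
        ∑ j ∈ Finset.range (Module.finrank ℝ E + 1),
          c j * LinearMap.det (1 + ((j : ℝ) * τ) • A) := by
  set s := Finset.range (Module.finrank ℝ E + 1) with hs
  let v : ℕ → ℝ := fun j ↦ (j : ℝ) * τ
  have hv : Set.InjOn v s := by
    intro i _ j _ hij
    simpa [v, hτ] using hij
  have hne : s.Nonempty := ⟨0, by simp [hs]⟩
  refine ⟨fun j ↦ (Lagrange.basis s v j).eval 1, ?_, fun A ↦ ?_⟩
  · have := congrArg (Polynomial.eval 1) (Lagrange.sum_basis hv hne)
    simpa [Polynomial.eval_finsetSum] using this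
  · let b := Module.finBasis ℝ E
    let M := LinearMap.toMatrix b b A
    let p : Polynomial ℝ := Matrix.det
      ((Polynomial.X : Polynomial ℝ) • M.map Polynomial.C + (1 : Matrix _ _ ℝ).map Polynomial.C)
    have hp : ∀ t : ℝ, p.eval t = LinearMap.det (1 + t • A) := by
      intro t
      rw [← LinearMap.det_toMatrix b, ← Polynomial.coe_evalRingHom, RingHom.map_det]
      congr 1
      ext i j
      rcases eq_or_ne i j with rfl | hij
      · simp [M, add_comm, mul_comm t]
      · simp [M, hij, mul_comm t]
    have hdeg : p.degree < (s.card : WithBot ℕ) := by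
      refine lt_of_le_of_lt Polynomial.degree_le_natDegree ?_
      have := Polynomial.natDegree_det_X_add_C_le M (1 : Matrix _ _ ℝ)
      rw [Fintype.card_fin] at this
      rw [hs, Finset.card_range]
      exact_mod_cast Nat.lt_succ_of_le this
    have h1 := hp 1
    rw [one_smul] at h1
    rw [← h1, Lagrange.eq_interpolate hv hdeg, Lagrange.interpolate_apply,
      Polynomial.eval_finsetSum]
    refine Finset.sum_congr rfl fun j _ ↦ ?_
    rw [Polynomial.eval_mul, Polynomial.eval_C, ← hp, mul_comm]

variable {E : Type*} [NormedAddCommGroup E] [InnerProductSpace ℝ E]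

theorem ContinuousLinearMap.det_one_add_smul_pos [FiniteDimensional ℝ E] {A : E →L[ℝ] E} {t : ℝ}
    (ht : |t| * ‖A‖ < 1) : 0 < (1 + t • A).det := by
  by_contra! hle
  have hc : ContinuousOn (fun s : ℝ ↦ (1 + (s * t) • A).det) (Icc 0 1) :=
    (ContinuousLinearMap.continuous_det.comp (by fun_prop)).continuousOn
  have h0 : (0 : ℝ) ∈ Icc ((1 + ((1 : ℝ) * t) • A).det) ((1 + ((0 : ℝ) * t) • A).det) := by
    constructor
    · simpa using hle
    · simp [ContinuousLinearMap.det]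
  obtain ⟨s, hs, hs0⟩ := intermediate_value_Icc' zero_le_one hc h0
  have hker : LinearMap.ker ((1 + (s * t) • A : E →L[ℝ] E) : E →ₗ[ℝ] E) ≠ ⊥ := by
    have : LinearMap.det ((1 + (s * t) • A : E →L[ℝ] E) : E →ₗ[ℝ] E) = 0 := hs0
    exact (LinearMap.bot_lt_ker_of_det_eq_zero this).ne'
  obtain ⟨v, hv, hv0⟩ := Submodule.exists_mem_ne_zero_of_ne_bot hker
  have hv1 : v = -((s * t) • A v) := by
    have : v + (s * t) • A v = 0 := by simpa using hv
    exact eq_neg_of_add_eq_zero_left this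
  have hpos : 0 < ‖v‖ := norm_pos_iff.mpr hv0
  have : ‖v‖ ≤ |t| * ‖A‖ * ‖v‖ := by
    calc ‖v‖ = |s| * |t| * ‖A v‖ := by
          conv_lhs => rw [hv1]
          rw [norm_neg, norm_smul, Real.norm_eq_abs, abs_mul]
      _ ≤ 1 * |t| * (‖A‖ * ‖v‖) := by
          gcongr
          · rw [abs_of_nonneg hs.1]; exact hs.2
          · exact A.le_opNorm v
      _ = _ := by ring
  nlinarith

/-- Extending by zero preserves the Lipschitz constant of a map vanishing on the sphere. -/
theorem LipschitzOnWith.indicator_closedBall {g : E → E} {K : NNReal} {R : ℝ}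
    (hg : LipschitzOnWith K g (closedBall 0 R)) (h0 : ∀ x ∈ sphere (0 : E) R, g x = 0) :
    LipschitzWith K ((closedBall (0 : E) R).indicator g) := by
  have key : ∀ x ∈ closedBall (0 : E) R, ∀ y ∉ closedBall (0 : E) R, ‖g x‖ ≤ K * dist x y := by
    intro x hx y hy
    rw [mem_closedBall_zero_iff] at hx hy
    have hc : ContinuousOn (fun s : ℝ ↦ ‖AffineMap.lineMap x y s‖) (Icc 0 1) :=
      (AffineMap.lineMap_continuous.norm).continuousOn
    obtain ⟨s, hs, hsR⟩ := intermediate_value_Icc zero_le_one hc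
      (show R ∈ _ by simpa using ⟨hx, (not_le.mp hy).le⟩)
    set z := AffineMap.lineMap x y s with hz
    have hzs : z ∈ sphere (0 : E) R := by simpa using hsR
    have := hg.dist_le_mul x (by simpa using hx) z (sphere_subset_closedBall hzs)
    rw [h0 z hzs, dist_zero_right] at this
    refine this.trans ?_
    gcongr
    rw [dist_comm, hz, dist_lineMap_left, Real.norm_eq_abs, abs_of_nonneg hs.1]
    exact mul_le_of_le_one_left dist_nonneg hs.2
  refine LipschitzWith.of_dist_le_mul fun x y ↦ ?_
  by_cases hx : x ∈ closedBall (0 : E) R <;> by_cases hy : y ∈ closedBall (0 : E) R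
  · simpa [hx, hy] using hg.dist_le_mul x hx y hy
  · simpa only [indicator_of_mem hx, indicator_of_notMem hy, dist_zero_right] using key x hx y hy
  · rw [indicator_of_mem hy, indicator_of_notMem hx, dist_zero_left, dist_comm x y]
    exact key y hy x hx
  · rw [indicator_of_notMem hx, indicator_of_notMem hy, dist_self]; positivity

theorem LipschitzWith.bijective_id_add_smul [CompleteSpace E] {g : E → E} {K : NNReal}
    (hg : LipschitzWith K g) {t : ℝ} (ht0 : 0 ≤ t) (ht : t * K < 1) :
    Function.Bijective fun x ↦ x + t • g x := by
  have hlip : ∀ y : E, ContractingWith (t.toNNReal * K) fun x ↦ y - t • g x := by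
    intro y
    refine ⟨?_, LipschitzWith.of_dist_le_mul fun a b ↦ ?_⟩
    · rw [← NNReal.coe_lt_coe]; simpa [ht0] using ht
    · rw [dist_sub_left, dist_smul₀, Real.norm_of_nonneg ht0, NNReal.coe_mul,
        Real.coe_toNNReal t ht0, mul_assoc]
      exact mul_le_mul_of_nonneg_left (hg.dist_le_mul a b) ht0
  refine ⟨fun a b hab ↦ ?_, fun y ↦ ?_⟩
  · refine (hlip (b + t • g b)).fixedPoint_unique' ?_ ?_
    · exact sub_eq_of_eq_add hab.symm
    · exact add_sub_cancel_right _ _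
  · refine ⟨(hlip y).fixedPoint, ?_⟩
    have := (hlip y).fixedPoint_isFixedPt
    exact (sub_eq_iff_eq_add.mp this.eq).symm

/-- There is no `C¹` retraction of a ball onto its boundary sphere. -/
theorem not_contDiff_retraction_sphere [FiniteDimensional ℝ E]
    {r : E → E} (hr : ContDiff ℝ 1 r) {R : ℝ} (hR : 0 < R)
    (hid : ∀ x ∈ sphere (0 : E) R, r x = x) (hnorm : ∀ x, ‖r x‖ = R) : False := by
  borelize E
  let μ : Measure E := Measure.addHaar
  have hdiff : ∀ x, HasFDerivAt r (fderiv ℝ r x) x := fun x ↦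
    (hr.differentiable one_ne_zero x).hasFDerivAt
  have hcont : Continuous (fderiv ℝ r) := hr.continuous_fderiv one_ne_zero
  let g : E → E := fun x ↦ r x - x
  let L : E → E →L[ℝ] E := fun x ↦ fderiv ℝ r x - 1
  have hL : Continuous L := hcont.sub continuous_const
  have hg : ∀ x, HasFDerivAt g (L x) x := fun x ↦ (hdiff x).sub (hasFDerivAt_id x)
  obtain ⟨K', hK'⟩ := ((isCompact_closedBall (0 : E) R).image hL.norm).bddAbove
  let K : NNReal := K'.toNNReal
  have hK : ∀ x ∈ closedBall (0 : E) R, ‖L x‖ ≤ K := fun x hx ↦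
    (hK' (mem_image_of_mem _ hx)).trans (Real.le_coe_toNNReal _)
  have hlip : LipschitzWith K ((closedBall (0 : E) R).indicator g) := by
    refine LipschitzOnWith.indicator_closedBall ?_ fun x hx ↦ by simp [g, hid x hx]
    exact (convex_closedBall (0 : E) R).lipschitzOnWith_of_nnnorm_hasFDerivWithin_le
      (fun x _ ↦ (hg x).hasFDerivWithinAt) hK
  have hint : ∀ t : ℝ, IntegrableOn (fun x ↦ (1 + t • L x).det) (ball 0 R) μ := fun t ↦
    ((ContinuousLinearMap.continuous_det.comp
      (by fun_prop)).continuousOn.integrableOn_compact (isCompact_closedBall 0 R)).mono_set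
        ball_subset_closedBall
  have hsmall : ∀ t : ℝ, 0 ≤ t → t * K < 1 →
      ∫ x in ball 0 R, (1 + t • L x).det ∂μ = μ.real (ball 0 R) := by
    intro t ht0 ht
    set f : E → E := fun x ↦ x + t • (closedBall (0 : E) R).indicator g x with hf
    have hbij : Function.Bijective f := hlip.bijective_id_add_smul ht0 ht
    have hout : ∀ x ∉ ball (0 : E) R, f x = x := by
      intro x hx
      have : (closedBall (0 : E) R).indicator g x = 0 := by
        by_cases hx' : x ∈ closedBall (0 : E) R
        · rw [indicator_of_mem hx']
          have : x ∈ sphere (0 : E) R := by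
            simp only [mem_ball, not_lt, mem_closedBall] at hx hx'
            exact le_antisymm hx' hx
          simp [g, hid x this]
        · exact indicator_of_notMem hx' _
      simp [hf, this]
    have himage : f '' ball 0 R = ball 0 R := by
      ext y
      constructor
      · rintro ⟨x, hx, rfl⟩
        by_contra hfx
        exact hfx (by rwa [hbij.injective (hout _ hfx)])
      · intro hy
        obtain ⟨x, rfl⟩ := hbij.surjective y
        by_cases hx : x ∈ ball (0 : E) R
        · exact mem_image_of_mem f hx
        · rw [hout x hx] at hy; exact absurd hy hx
    have hderiv : ∀ x ∈ ball (0 : E) R, HasFDerivWithinAt f (1 + t • L x) (ball 0 R) x := by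
      intro x hx
      have : HasFDerivAt (fun x ↦ x + t • g x) (1 + t • L x) x :=
        (hasFDerivAt_id x).add ((hg x).const_smul t)
      refine this.hasFDerivWithinAt.congr (fun y hy ↦ ?_) ?_
      · simp [hf, indicator_of_mem (ball_subset_closedBall hy)]
      · simp [hf, indicator_of_mem (ball_subset_closedBall hx)]
    have hcv := integral_image_eq_integral_abs_det_fderiv_smul μ measurableSet_ball hderiv
      hbij.injective.injOn (fun _ ↦ (1 : ℝ))
    rw [himage] at hcv
    simp only [smul_eq_mul, mul_one, integral_const, MeasurableSet.univ,
      measureReal_restrict_apply, univ_inter] at hcv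
    rw [hcv]
    refine setIntegral_congr_fun measurableSet_ball fun x hx ↦ ?_
    refine (abs_of_pos (ContinuousLinearMap.det_one_add_smul_pos ?_)).symm
    rw [abs_of_nonneg ht0]
    exact (mul_le_mul_of_nonneg_left (hK x (ball_subset_closedBall hx)) ht0).trans_lt ht
  set n := Module.finrank ℝ E with hn
  let τ : ℝ := ((n + 1) * (K + 1))⁻¹
  have hτ : 0 < τ := by positivity
  obtain ⟨c, hc1, hc⟩ := LinearMap.exists_det_one_add_eq_sum (E := E) hτ.ne'
  have htotal : ∫ x in ball 0 R, (1 + (1 : ℝ) • L x).det ∂μ = μ.real (ball 0 R) := by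
    have heq : ∀ x, (1 + (1 : ℝ) • L x).det =
        ∑ j ∈ Finset.range (n + 1), c j * (1 + ((j : ℝ) * τ) • L x).det := by
      intro x
      rw [one_smul]
      exact hc (L x : E →ₗ[ℝ] E)
    simp_rw [heq]
    rw [integral_finsetSum _ fun j _ ↦ (hint _).const_mul _]
    simp_rw [integral_const_mul]
    have hnode : ∀ j ∈ Finset.range (n + 1), (j : ℝ) * τ * K < 1 := by
      intro j hj
      have hj' : (j : ℝ) < n + 1 := by exact_mod_cast Finset.mem_range.mp hj
      have hK0 : (0 : ℝ) ≤ K := K.2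
      rw [show (j : ℝ) * τ * K = (j / (n + 1)) * (K / (K + 1)) by
        simp only [τ]; field_simp]
      have h1 : (j : ℝ) / (n + 1) < 1 := by rw [div_lt_one (by positivity)]; exact hj'
      have h2 : (K : ℝ) / (K + 1) < 1 := by rw [div_lt_one (by positivity)]; linarith
      have h3 : (0 : ℝ) ≤ j / (n + 1) := by positivity
      nlinarith
    rw [Finset.sum_congr rfl fun j hj ↦ by rw [hsmall _ (by positivity) (hnode j hj)],
      ← Finset.sum_mul, hc1, one_mul]
  have hzero : ∀ x, (1 + (1 : ℝ) • L x).det = 0 := by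
    intro x
    have h1 : (1 : E →L[ℝ] E) + (1 : ℝ) • L x = fderiv ℝ r x := by simp [L]
    rw [h1]
    by_contra hdet
    have hsurj : Function.Surjective (fderiv ℝ r x) :=
      (LinearMap.equivOfDetNeZero (fderiv ℝ r x : E →ₗ[ℝ] E) hdet).surjective
    obtain ⟨v, hv⟩ := hsurj (r x)
    have h2 := (hdiff x).norm_sq
    have h3 : (fun y ↦ ‖r y‖ ^ 2) = fun _ ↦ R ^ 2 := by ext y; rw [hnorm]
    rw [h3] at h2
    have h4 := congrArg (fun A : E →L[ℝ] ℝ ↦ A v) (h2.unique (hasFDerivAt_const _ _))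
    simp [hv, hnorm, hR.ne'] at h4
  simp_rw [hzero, integral_zero] at htotal
  have : 0 < μ.real (ball (0 : E) R) := by
    rw [measureReal_def]
    exact ENNReal.toReal_pos (measure_ball_pos _ _ hR).ne' measure_ball_lt_top.ne
  exact this.ne htotal

end Brouwer

section InvarianceOfDomain

open MeasureTheory

variable {E : Type*} [NormedAddCommGroup E] [InnerProductSpace ℝ E] [FiniteDimensional ℝ E]

theorem exists_eq_zero_of_eq_id_outside_ball {F : E → E} (hF : Continuous F) {R : ℝ} (hR : 0 < R)
    (hid : ∀ x, R ≤ ‖x‖ → F x = x) : ∃ x, F x = 0 := by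
  by_contra! hne
  obtain ⟨c, hc, hcF, hsupp⟩ := (hF.sub continuous_id).exists_contDiff_approx 1 hF.norm
    fun x ↦ norm_pos_iff.mpr (hne x)
  let G : E → E := fun x ↦ x + c x
  have hG : ContDiff ℝ 1 G := contDiff_id.add (by exact_mod_cast hc)
  have hG0 : ∀ x, G x ≠ 0 := by
    intro x hx
    have h1 := hcF x
    rw [dist_eq_norm, show c x - (F - id : E → E) x = G x - F x by
      simp only [Pi.sub_apply, id, G]; abel, hx,
      zero_sub, norm_neg] at h1
    exact lt_irrefl _ h1
  have hGid : ∀ x, R ≤ ‖x‖ → G x = x := by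
    intro x hx
    have : c x = 0 := by
      by_contra hcx
      exact hsupp hcx (by simp [hid x hx])
    simp [G, this]
  refine not_contDiff_retraction_sphere (r := fun x ↦ (R / ‖G x‖) • G x) ?_ hR ?_ ?_
  · exact (contDiff_const.div (hG.norm ℝ hG0) fun x ↦ norm_ne_zero_iff.mpr (hG0 x)).smul hG
  · intro x hx
    rw [mem_sphere_zero_iff_norm] at hx
    simp [hGid x hx.ge, hx, hR.ne']
  · intro x
    have := norm_ne_zero_iff.mpr (hG0 x)
    rw [norm_smul, norm_div, norm_norm, div_mul_cancel₀ _ this, Real.norm_of_nonneg hR.le]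

/-- **Brouwer's fixed point theorem**, for a continuous map of the whole space into the closed
unit ball. -/
theorem exists_fixedPoint_of_norm_le_one {T : E → E} (hT : Continuous T) (h1 : ∀ x, ‖T x‖ ≤ 1) :
    ∃ x, T x = x := by
  let l : E → ℝ := fun x ↦ max 0 (min 1 (2 - ‖x‖))
  have hl : Continuous l := by fun_prop
  obtain ⟨x, hx⟩ := exists_eq_zero_of_eq_id_outside_ball (F := fun x ↦ x - l x • T x)
    (by fun_prop) two_pos fun x hx ↦ by
      have : l x = 0 := max_eq_left ((min_le_right _ _).trans (by linarith))
      simp [this]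
  have hx' : x = l x • T x := sub_eq_zero.mp hx
  have hl0 : 0 ≤ l x := le_max_left _ _
  have hl1 : l x ≤ 1 := max_le zero_le_one (min_le_left _ _)
  have hnorm : ‖x‖ ≤ 1 := by
    rw [hx', norm_smul, Real.norm_of_nonneg hl0]
    nlinarith [h1 x, norm_nonneg (T x)]
  have : l x = 1 := by
    simp only [l]
    rw [min_eq_left (by linarith), max_eq_right zero_le_one]
  rw [this, one_smul] at hx'
  exact ⟨x, hx'.symm⟩

/-- A continuous left inverse `G` of a map `f` of the closed unit ball has a zero on the image,
and this zero is stable under perturbations. -/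
theorem exists_eq_zero_of_norm_sub_leftInverse_le_one {f G H : E → E}
    (hf : ContinuousOn f (closedBall 0 1)) (hG : Continuous G)
    (hGf : ∀ x ∈ closedBall (0 : E) 1, G (f x) = x)
    (hH : ContinuousOn H (f '' closedBall 0 1))
    (hGH : ∀ y ∈ f '' closedBall 0 1, ‖G y - H y‖ ≤ 1) :
    ∃ y ∈ f '' closedBall 0 1, H y = 0 := by
  let p : E → E := fun x ↦ (max 1 ‖x‖)⁻¹ • x
  have hpos : ∀ x : E, 0 < max 1 ‖x‖ := fun x ↦ lt_max_of_lt_left one_pos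
  have hp : Continuous p :=
    ((continuous_const.max continuous_norm).inv₀ fun x ↦ (hpos x).ne').smul continuous_id
  have hpB : ∀ x, p x ∈ closedBall (0 : E) 1 := by
    intro x
    rw [mem_closedBall_zero_iff, norm_smul, norm_inv, Real.norm_of_nonneg (hpos x).le,
      inv_mul_le_one₀ (hpos x)]
    exact le_max_right _ _
  have hpid : ∀ x, ‖x‖ ≤ 1 → p x = x := fun x hx ↦ by simp [p, max_eq_left hx]
  have hfp : Continuous fun x ↦ f (p x) := hf.comp_continuous hp hpB
  have hmem : ∀ x, f (p x) ∈ f '' closedBall 0 1 := fun x ↦ mem_image_of_mem f (hpB x)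
  obtain ⟨x, hx⟩ := exists_fixedPoint_of_norm_le_one (T := fun x ↦ G (f (p x)) - H (f (p x)))
    ((hG.comp hfp).sub (hH.comp_continuous hfp hmem)) fun x ↦ hGH _ (hmem x)
  have hx1 : ‖x‖ ≤ 1 := by
    have := hGH _ (hmem x)
    rwa [hx] at this
  refine ⟨_, hmem x, ?_⟩
  rw [hGf _ (hpB x)] at hx
  rw [hpid x hx1] at hx ⊢
  exact sub_eq_self.mp hx

theorem image_closedBall_one_mem_nhds {f : E → E} (hf : ContinuousOn f (closedBall 0 1))
    (hinj : InjOn f (closedBall 0 1)) : f '' closedBall 0 1 ∈ 𝓝 (f 0) := by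
  borelize E
  let μ : Measure E := Measure.addHaar
  have hcpt : IsCompact (closedBall (0 : E) 1) := isCompact_closedBall 0 1
  have : CompactSpace (closedBall (0 : E) 1) := isCompact_iff_compactSpace.mp hcpt
  have hemb : IsClosedEmbedding ((closedBall (0 : E) 1).domRestrict f) :=
    hf.domRestrict.isClosedEmbedding hinj.injective
  obtain ⟨G, hG⟩ := ContinuousMap.exists_extension hemb
    (⟨Subtype.val, continuous_subtype_val⟩ : C(closedBall (0 : E) 1, E))
  have hGf : ∀ x ∈ closedBall (0 : E) 1, G (f x) = x := fun x hx ↦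
    congrArg (fun g : C(closedBall (0 : E) 1, E) ↦ g ⟨x, hx⟩) hG
  have h0 : (0 : E) ∈ closedBall (0 : E) 1 := by simp
  obtain ⟨ρ, hρ, hGρ⟩ := Metric.continuousAt_iff.mp
    (G.continuous.continuousAt (x := f 0)) (1 / 10) (by norm_num)
  rw [hGf 0 h0] at hGρ
  simp only [dist_zero_right] at hGρ
  by_contra hnot
  set ε := ρ / 2 with hεdef
  have hε : 0 < ε := half_pos hρ
  obtain ⟨c, hcball, hc⟩ : ∃ c ∈ ball (f 0) ε, c ∉ f '' closedBall 0 1 :=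
    not_subset.mp fun h ↦ hnot (Filter.mem_of_superset (ball_mem_nhds _ hε) h)
  rw [mem_ball] at hcball
  let S₁ : Set E := f '' closedBall 0 1 ∩ {y | ε ≤ dist y c}
  have hS₁ : IsCompact S₁ := (hcpt.image_of_continuousOn hf).inter_right
    (isClosed_le continuous_const (continuous_id.dist continuous_const))
  have hGS₁ : ∀ y ∈ S₁, 0 < ‖G y‖ := by
    rintro _ ⟨⟨x, hx, rfl⟩, hy⟩
    rw [hGf x hx, norm_pos_iff]
    rintro rfl
    rw [mem_ofPred_eq, dist_comm] at hy
    exact hcball.not_ge hy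
  obtain ⟨δ, hδ, hGδ⟩ := hS₁.exists_forall_le' G.continuous.norm.continuousOn hGS₁
  set η := min (δ / 2) (1 / 10) with hηdef
  have hη : 0 < η := lt_min (half_pos hδ) (by norm_num)
  have hηδ : η ≤ δ / 2 := min_le_left _ _
  have hη10 : η ≤ 1 / 10 := min_le_right _ _
  obtain ⟨P, hP, hPG, -⟩ := G.continuous.exists_contDiff_approx 1 (continuous_const (y := η))
    fun _ ↦ hη
  have hnull : μ (P '' sphere c ε) = 0 :=
    addHaar_image_eq_zero_of_differentiableOn_of_addHaar_eq_zero μ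
      (hP.differentiable (by norm_num)).differentiableOn
        (Measure.addHaar_sphere_of_ne_zero μ c hε.ne')
  obtain ⟨v, hv, hvP⟩ : ∃ v ∈ ball (0 : E) η, v ∉ P '' sphere c ε :=
    not_subset.mp fun h ↦ (measure_ball_pos μ 0 hη).ne' (measure_mono_null h hnull)
  rw [mem_ball_zero_iff] at hv
  let Φ : E → E := fun y ↦ c + max (ε / dist y c) 1 • (y - c)
  have hne : ∀ y ∈ f '' closedBall 0 1, dist y c ≠ 0 := fun y hy h ↦
    hc (by rwa [dist_eq_zero.mp h] at hy)
  have hΦ : ContinuousOn Φ (f '' closedBall 0 1) := by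
    refine continuousOn_const.add (ContinuousOn.smul ?_ (by fun_prop))
    exact (continuousOn_const.div (by fun_prop) hne).sup continuousOn_const
  have hΦ₁ : ∀ y, ε ≤ dist y c → Φ y = y := by
    intro y hy
    have : ε / dist y c ≤ 1 := (div_le_one (hε.trans_le hy)).mpr hy
    simp [Φ, max_eq_right this]
  have hΦ₂ : ∀ y ∈ f '' closedBall 0 1, dist y c < ε → Φ y ∈ sphere c ε := by
    intro y hy hyc
    have hpos : 0 < dist y c := lt_of_le_of_ne dist_nonneg (hne y hy).symm
    have : 1 ≤ ε / dist y c := (one_le_div hpos).mpr hyc.le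
    simp only [Φ, max_eq_left this, mem_sphere, dist_self_add_left]
    rw [norm_smul, ← dist_eq_norm, norm_div, Real.norm_of_nonneg hε.le,
      Real.norm_of_nonneg hpos.le, div_mul_cancel₀ _ hpos.ne']
  obtain ⟨y, hy, hy0⟩ := exists_eq_zero_of_norm_sub_leftInverse_le_one
    (H := fun y ↦ P (Φ y) - v) hf G.continuous hGf
    ((hP.continuous.comp_continuousOn hΦ).sub continuousOn_const) fun y hy ↦ by
      have hPy := hPG (Φ y)
      rw [dist_comm, dist_eq_norm] at hPy
      have hsplit : G y - (P (Φ y) - v) = (G y - G (Φ y)) + (G (Φ y) - P (Φ y)) + v := by abel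
      have h3 := norm_add₃_le (a := G y - G (Φ y)) (b := G (Φ y) - P (Φ y)) (c := v)
      rw [hsplit]
      rcases le_or_gt ε (dist y c) with h | h
      · rw [hΦ₁ y h] at hPy h3 ⊢
        rw [sub_self] at h3 ⊢
        rw [norm_zero] at h3
        linarith
      · have h4 : ‖G y‖ < 1 / 10 := hGρ (by
          have := dist_triangle y c (f 0); linarith)
        have h5 : ‖G (Φ y)‖ < 1 / 10 := hGρ (by
          have := dist_triangle (Φ y) c (f 0)
          rw [mem_sphere.mp (hΦ₂ y hy h)] at this; linarith)
        have := norm_sub_le (G y) (G (Φ y))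
        linarith
  have hPv : P (Φ y) = v := sub_eq_zero.mp hy0
  rcases le_or_gt ε (dist y c) with h | h
  · rw [hΦ₁ y h] at hPv
    have h1 := hGδ y ⟨hy, h⟩
    have h2 := hPG y
    rw [hPv, dist_comm, dist_eq_norm] at h2
    have h3 := norm_sub_norm_le (G y) v
    linarith
  · exact hvP ⟨Φ y, hΦ₂ y hy h, hPv⟩

/-- **Invariance of domain.** -/
theorem IsOpen.isOpen_image_of_continuousOn_of_injOn {s : Set E} (hs : IsOpen s) {f : E → E}
    (hf : ContinuousOn f s) (hinj : InjOn f s) : IsOpen (f '' s) := by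
  rw [isOpen_iff_mem_nhds]
  rintro _ ⟨a, ha, rfl⟩
  obtain ⟨r, hr, hrs⟩ := Metric.nhds_basis_closedBall.mem_iff.mp (hs.mem_nhds ha)
  let φ : E → E := fun x ↦ a + r • x
  have hφ : Continuous φ := by fun_prop
  have hmaps : MapsTo φ (closedBall 0 1) s := fun x hx ↦ hrs (by
    rw [mem_closedBall_zero_iff] at hx
    rw [mem_closedBall, dist_self_add_left, norm_smul, Real.norm_of_nonneg hr.le]
    nlinarith)
  have hφinj : Function.Injective φ := fun x y hxy ↦
    smul_right_injective E hr.ne' (add_left_cancel hxy)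
  have := image_closedBall_one_mem_nhds (hf.comp hφ.continuousOn hmaps)
    (hinj.comp hφinj.injOn hmaps)
  simp only [Function.comp_apply, φ, smul_zero, add_zero] at this
  refine Filter.mem_of_superset this ?_
  rintro _ ⟨x, hx, rfl⟩
  exact mem_image_of_mem f (hmaps hx)

end InvarianceOfDomain

section Shears

/-- A compact totally disconnected set can be embedded into the real line. -/
theorem IsCompact.exists_continuous_injOn_real {X : Type*} [MetricSpace X] {L : Set X}
    (hL : IsCompact L) (htd : IsTotallyDisconnected L) :
    ∃ f : X → ℝ, Continuous f ∧ InjOn f L := by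
  have : CompactSpace L := isCompact_iff_compactSpace.mp hL
  have : TotallyDisconnectedSpace L := totallyDisconnectedSpace_subtype_iff.mpr htd
  have : Countable (TopologicalSpace.Clopens L) :=
    TopologicalSpace.Clopens.countable_iff_secondCountable.mpr inferInstance
  obtain ⟨s, hs⟩ := exists_surjective_nat (TopologicalSpace.Clopens L)
  let g : L → ℕ → Bool := fun x k ↦ (s k : Set L).boolIndicator x
  have hg : Continuous g := continuous_pi fun k ↦
    (continuous_boolIndicator_iff_isClopen _).mpr (s k).isClopen
  have hginj : Function.Injective g := by
    intro x y hxy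
    by_contra hne
    obtain ⟨C, hC, hx, hy⟩ := exists_isClopen_of_totally_separated hne
    obtain ⟨k, hk⟩ := hs ⟨C, hC⟩
    have := congrFun hxy k
    simp only [g, hk] at this
    exact hy ((mem_iff_boolIndicator _ _).mpr (this ▸ (mem_iff_boolIndicator _ _).mp hx))
  let φ : C(L, ℝ) := ⟨fun x ↦ (cantorSetHomeomorphNatToBool.symm (g x) : ℝ), by fun_prop⟩
  obtain ⟨f, hf⟩ := φ.exists_restrict_eq hL.isClosed
  refine ⟨f, f.continuous, fun x hx y hy hxy ↦ ?_⟩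
  have key : ∀ z (hz : z ∈ L), f z = φ ⟨z, hz⟩ := fun z hz ↦
    congrArg (fun u : C(L, ℝ) ↦ u ⟨z, hz⟩) hf
  rw [key x hx, key y hy] at hxy
  exact congrArg Subtype.val
    (hginj (cantorSetHomeomorphNatToBool.symm.injective (Subtype.val_injective hxy)))

/-- Translation by a vector field `w` which is invariant under its own translations. -/
def Homeomorph.shear {E : Type*} [AddCommGroup E] [TopologicalSpace E] [IsTopologicalAddGroup E]
    (w : E → E) (hw : Continuous w) (hadd : ∀ y, w (y + w y) = w y)
    (hsub : ∀ y, w (y - w y) = w y) : E ≃ₜ E where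
  toFun y := y + w y
  invFun y := y - w y
  left_inv y := by simp [hadd]
  right_inv y := by simp [hsub]
  continuous_toFun := by fun_prop
  continuous_invFun := by fun_prop

variable {n : ℕ}

theorem EuclideanSpace.continuous_single (i : Fin n) :
    Continuous fun t : ℝ ↦ (EuclideanSpace.single i t : EuclideanSpace ℝ (Fin n)) :=
  Isometry.continuous (Isometry.of_dist_eq fun a b ↦ PiLp.dist_single_same 2 (fun _ ↦ ℝ) i a b)

theorem exists_homeomorph_image_subset_axis {X : Set (EuclideanSpace ℝ (Fin n))} (hX : IsCompact X)
    {i : Fin n} (hinj : InjOn (fun x : EuclideanSpace ℝ (Fin n) ↦ x i) X) :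
    ∃ h : EuclideanSpace ℝ (Fin n) ≃ₜ EuclideanSpace ℝ (Fin n),
      ∀ x ∈ X, h x = EuclideanSpace.single i (x i) := by
  have : CompactSpace X := isCompact_iff_compactSpace.mp hX
  have hc : Continuous fun x : EuclideanSpace ℝ (Fin n) ↦ x i := by fun_prop
  have hemb : IsClosedEmbedding (X.domRestrict fun x : EuclideanSpace ℝ (Fin n) ↦ x i) :=
    hc.continuousOn.domRestrict.isClosedEmbedding hinj.injective
  obtain ⟨G, hG⟩ := ContinuousMap.exists_extension hemb
    (⟨Subtype.val, continuous_subtype_val⟩ : C(X, EuclideanSpace ℝ (Fin n)))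
  have hGx : ∀ x ∈ X, G (x i) = x := fun x hx ↦
    congrArg (fun g : C(X, EuclideanSpace ℝ (Fin n)) ↦ g ⟨x, hx⟩) hG
  let w : EuclideanSpace ℝ (Fin n) → EuclideanSpace ℝ (Fin n) := fun y ↦
    EuclideanSpace.single i (G (y i) i) - G (y i)
  have hwi : ∀ y, w y i = 0 := fun y ↦ by simp [w]
  have hweq : ∀ y z, y i = z i → w y = w z := fun y z h ↦ by simp only [w, h]
  refine ⟨Homeomorph.shear w ?_ (fun y ↦ hweq _ _ (by simp [hwi]))
    (fun y ↦ hweq _ _ (by simp [hwi])), fun x hx ↦ ?_⟩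
  · exact ((EuclideanSpace.continuous_single i).comp (by fun_prop)).sub (by fun_prop)
  · simp [Homeomorph.shear, w, hGx x hx]

/-- **Klee's trick.** -/
theorem exists_homeomorph_injOn_coord {L : Set (EuclideanSpace ℝ (Fin n))} (hL : IsCompact L)
    (htd : IsTotallyDisconnected L) {i : Fin n} (hi : ∀ x ∈ L, x i = 0) :
    ∃ h : EuclideanSpace ℝ (Fin n) ≃ₜ EuclideanSpace ℝ (Fin n),
      InjOn (fun x ↦ h x i) L := by
  obtain ⟨f, hf, hinj⟩ := hL.exists_continuous_injOn_real htd
  let p : EuclideanSpace ℝ (Fin n) → EuclideanSpace ℝ (Fin n) := fun y ↦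
    y - EuclideanSpace.single i (y i)
  have hp : Continuous p :=
    continuous_id.sub ((EuclideanSpace.continuous_single i).comp (by fun_prop))
  let w : EuclideanSpace ℝ (Fin n) → EuclideanSpace ℝ (Fin n) := fun y ↦
    EuclideanSpace.single i (f (p y))
  have hpw : ∀ y (t : ℝ), p (y + EuclideanSpace.single i t) = p y := by
    intro y t
    ext j
    by_cases hj : j = i <;> simp [p, hj]
  refine ⟨Homeomorph.shear w ((EuclideanSpace.continuous_single i).comp (hf.comp hp))
    (fun y ↦ ?_) fun y ↦ ?_, fun x hx y hy hxy ↦ hinj hx hy ?_⟩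
  · simp only [w, hpw]
  · have : ∀ t : ℝ, p (y - EuclideanSpace.single i t) = p y := fun t ↦ by
      rw [← hpw (y - EuclideanSpace.single i t) t, sub_add_cancel]
    simp only [w, this]
  · have hpL : ∀ z ∈ L, p z = z := fun z hz ↦ by
      ext j
      by_cases hj : j = i <;> simp [p, hi z hz, hj]
    simpa [Homeomorph.shear, w, hpL x hx, hpL y hy, hi x hx, hi y hy] using hxy

end Shears

section RadialShrinking

variable {E : Type*} [NormedAddCommGroup E] [InnerProductSpace ℝ E] [FiniteDimensional ℝ E]

/-- A continuous bijection of a finite-dimensional space onto itself is a homeomorphism. -/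
theorem exists_homeomorph_of_continuous_bijective {f : E → E} (hf : Continuous f)
    (hb : Function.Bijective f) : ∃ h : E ≃ₜ E, ∀ y, h y = f y :=
  ⟨(Equiv.ofBijective f hb).toHomeomorphOfContinuousOpen hf fun _ hs ↦
    hs.isOpen_image_of_continuousOn_of_injOn hf.continuousOn hb.injective.injOn, fun _ ↦ rfl⟩

theorem exists_homeomorph_radial_shrink (q : E) {r R η : ℝ} (hr : 0 ≤ r) (hrR : r < R)
    (hη : 0 < η) :
    ∃ θ : E ≃ₜ E, (∀ y ∉ ball q R, θ y = y) ∧ ∀ y ∈ closedBall q r, θ y ∈ ball q η := by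
  have hR : 0 < R := hr.trans_lt hrR
  obtain ⟨p, hp⟩ : ∃ p : ℕ, (r / R) ^ p < η / R :=
    exists_pow_lt_of_lt_one (by positivity) ((div_lt_one hR).mpr hrR)
  let s : ℝ → ℝ := fun t ↦ (min 1 (t / R)) ^ p
  have hs : Continuous s := by fun_prop
  have hs0 : ∀ t, 0 < t → 0 < s t := fun t ht ↦ pow_pos (lt_min one_pos (by positivity)) _
  have hs0' : ∀ t, 0 ≤ t → 0 ≤ s t := fun t ht ↦ pow_nonneg (le_min zero_le_one (by positivity)) _
  have hs1 : ∀ t, R ≤ t → s t = 1 := fun t ht ↦ by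
    simp [s, min_eq_left ((one_le_div hR).mpr ht)]
  have hmono : ∀ a b, 0 ≤ a → a ≤ b → s a ≤ s b := fun a b ha hab ↦
    pow_le_pow_left₀ (le_min zero_le_one (by positivity)) (by gcongr) _
  have hlt : ∀ a b, 0 ≤ a → a < b → s a * a < s b * b := fun a b ha hab ↦
    (mul_le_mul_of_nonneg_right (hmono a b ha hab.le) ha).trans_lt
      (mul_lt_mul_of_pos_left hab (hs0 b (ha.trans_lt hab)))
  let f : E → E := fun y ↦ q + s ‖y - q‖ • (y - q)
  have hnorm : ∀ y, ‖f y - q‖ = s ‖y - q‖ * ‖y - q‖ := fun y ↦ by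
    simp [f, norm_smul, abs_of_nonneg (hs0' _ (norm_nonneg (y - q)))]
  have hinj : Function.Injective f := by
    intro y z hyz
    have h1 : ‖y - q‖ = ‖z - q‖ := by
      have := hnorm y
      rw [hyz, hnorm z] at this
      rcases lt_trichotomy ‖y - q‖ ‖z - q‖ with h | h | h
      · exact absurd this (hlt _ _ (norm_nonneg _) h).ne'
      · exact h
      · exact absurd this (hlt _ _ (norm_nonneg _) h).ne
    rcases (norm_nonneg (y - q)).eq_or_lt with h | h
    · rw [sub_eq_zero.mp (norm_eq_zero.mp h.symm),
        sub_eq_zero.mp (norm_eq_zero.mp (h1.symm.trans h.symm))]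
    · have h2 : s ‖y - q‖ • (y - q) = s ‖y - q‖ • (z - q) := by
        simpa [f, ← h1] using hyz
      exact sub_left_injective (smul_right_injective E (hs0 _ h).ne' h2)
  have hsurj : Function.Surjective f := by
    intro z
    by_cases hz : z = q
    · exact ⟨q, by simp [f, hz]⟩
    have hv : 0 < ‖z - q‖ := norm_pos_iff.mpr (sub_ne_zero.mpr hz)
    have hM : 0 ≤ max 1 (R / ‖z - q‖) := zero_le_one.trans (le_max_left _ _)
    obtain ⟨c, hc, hc1⟩ : (1 : ℝ) ∈
        (fun c ↦ s (c * ‖z - q‖) * c) '' Icc 0 (max 1 (R / ‖z - q‖)) := by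
      refine intermediate_value_Icc hM (by fun_prop) ⟨by simp, ?_⟩
      rw [hs1 _ ((div_le_iff₀ hv).mp (le_max_right _ _)), one_mul]
      exact le_max_left _ _
    refine ⟨q + c • (z - q), ?_⟩
    have : ‖c • (z - q)‖ = c * ‖z - q‖ := by rw [norm_smul, Real.norm_of_nonneg hc.1]
    simp only [f, add_sub_cancel_left, this, smul_smul]
    simp only at hc1
    simp [hc1]
  obtain ⟨θ, hθ⟩ := exists_homeomorph_of_continuous_bijective (f := f) (by fun_prop) ⟨hinj, hsurj⟩
  refine ⟨θ, fun y hy ↦ ?_, fun y hy ↦ ?_⟩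
  · rw [mem_ball, dist_eq_norm, not_lt] at hy
    simp [hθ, f, hs1 _ hy]
  · rw [mem_closedBall, dist_eq_norm] at hy
    rw [mem_ball, dist_eq_norm, hθ, hnorm]
    calc s ‖y - q‖ * ‖y - q‖ ≤ s r * r :=
          mul_le_mul (hmono _ _ (norm_nonneg _) hy) hy (norm_nonneg _) (hs0' _ hr)
      _ ≤ (r / R) ^ p * R :=
          mul_le_mul (pow_le_pow_left₀ (le_min zero_le_one (by positivity)) (min_le_right _ _) _)
            hrR.le hr (by positivity)
      _ < η := (lt_div_iff₀ hR).mp hp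

/-- Simultaneous radial shrinking in finitely many disjoint regions. -/
theorem exists_homeomorph_radial_shrink_finset {ι : Type*} (J : Finset ι) (B : ι → Set E)
    (hB : (J : Set ι).PairwiseDisjoint B) (q : ι → E) (r R η : ι → ℝ)
    (hr : ∀ j ∈ J, 0 ≤ r j) (hrR : ∀ j ∈ J, r j < R j) (hη : ∀ j ∈ J, 0 < η j)
    (hRB : ∀ j ∈ J, ball (q j) (R j) ⊆ B j) :
    ∃ θ : E ≃ₜ E, (∀ y, (∀ j ∈ J, y ∉ B j) → θ y = y) ∧ (∀ j ∈ J, ∀ y ∈ B j, θ y ∈ B j) ∧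
      ∀ j ∈ J, ∀ y ∈ closedBall (q j) (r j), θ y ∈ ball (q j) (η j) := by
  classical
  induction J using Finset.induction_on with
  | empty => exact ⟨Homeomorph.refl E, by simp⟩
  | insert a J ha ih =>
    simp only [Finset.forall_mem_insert] at hr hrR hη hRB ⊢
    obtain ⟨θ, h1, h2, h3⟩ := ih (hB.subset (by simp)) hr.2 hrR.2 hη.2 hRB.2
    obtain ⟨σ, k1, k2⟩ := exists_homeomorph_radial_shrink (q a) hr.1 hrR.1 hη.1
    have hdis : ∀ j ∈ J, ∀ y ∈ B j, y ∉ B a := fun j hj y hy hya ↦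
      disjoint_left.mp (hB (by simp [hj]) (by simp) (ne_of_mem_of_not_mem hj ha)) hy hya
    have hσB : ∀ y ∈ B a, σ y ∈ B a := by
      intro y hy
      by_cases hyb : y ∈ ball (q a) (R a)
      · by_contra hn
        have h := k1 (σ y) fun h ↦ hn (hRB.1 h)
        rw [σ.injective h] at hn
        exact hn hy
      · rwa [k1 y hyb]
    have hσ : ∀ y ∉ B a, σ y = y := fun y hy ↦ k1 y fun h ↦ hy (hRB.1 h)
    have hθ : ∀ y ∈ B a, θ y = y := fun y hy ↦ h1 y fun j hj hyj ↦ hdis j hj y hyj hy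
    have hθσ : ∀ j ∈ J, ∀ y ∈ B j, σ (θ y) = θ y := fun j hj y hy ↦
      hσ _ (hdis j hj _ (h2 j hj y hy))
    refine ⟨θ.trans σ, fun y hy ↦ ?_, ⟨fun y hy ↦ ?_, fun j hj y hy ↦ ?_⟩, fun y hy ↦ ?_,
      fun j hj y hy ↦ ?_⟩
    · rw [Homeomorph.trans_apply, h1 y hy.2, hσ y hy.1]
    · rw [Homeomorph.trans_apply, hθ y hy]
      exact hσB y hy
    · rw [Homeomorph.trans_apply, hθσ j hj y hy]
      exact h2 j hj y hy
    · rw [Homeomorph.trans_apply,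
        hθ y (hRB.1 (closedBall_subset_ball hrR.1 hy))]
      exact k2 y hy
    · rw [Homeomorph.trans_apply, hθσ j hj y (hRB.2 j hj (closedBall_subset_ball (hrR.2 j hj) hy))]
      exact h3 j hj y hy

end RadialShrinking

/-- Transport of a compactly supported homeomorphism through a chart. -/
theorem exists_homeomorph_transport {X Y : Type*} [TopologicalSpace X] [T2Space X]
    [TopologicalSpace Y] (e : OpenPartialHomeomorph X Y) (θ : Y ≃ₜ Y) {D : Set Y}
    (hD : IsCompact D) (hDe : D ⊆ e.target) (hθ : ∀ y ∉ D, θ y = y) :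
    ∃ Θ : X ≃ₜ X, (∀ y ∈ e.source, e (Θ y) = θ (e y) ∧ Θ y ∈ e.source) ∧
      ∀ y ∉ e.source, Θ y = y := by
  classical
  have hmem : ∀ σ : Y ≃ₜ Y, (∀ y ∉ D, σ y = y) → ∀ y ∈ e.target, σ y ∈ e.target := by
    intro σ hσ y hy
    by_contra hn
    have := hσ (σ y) fun h ↦ hn (hDe h)
    exact hn (by rwa [σ.injective this])
  have hsymm : ∀ y ∉ D, θ.symm y = y := fun y hy ↦ by
    rw [Homeomorph.symm_apply_eq, hθ y hy]
  let F : (Y ≃ₜ Y) → X → X := fun σ y ↦ if y ∈ e.source then e.symm (σ (e y)) else y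
  have hF : ∀ σ, ∀ y ∈ e.source, F σ y = e.symm (σ (e y)) := fun σ y hy ↦ if_pos hy
  have hF' : ∀ σ, ∀ y ∉ e.source, F σ y = y := fun σ y hy ↦ if_neg hy
  have hcont : ∀ σ : Y ≃ₜ Y, (∀ y ∉ D, σ y = y) → Continuous (F σ) := by
    intro σ hσ
    have hcl : IsClosed (e.symm '' D) :=
      (hD.image_of_continuousOn (e.continuousOn_symm.mono hDe)).isClosed
    rw [continuous_iff_continuousAt]
    intro y
    by_cases hy : y ∈ e.source
    · have h1 : ContinuousOn (fun y ↦ e.symm (σ (e y))) e.source :=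
        e.continuousOn_symm.comp (σ.continuous.comp_continuousOn e.continuousOn)
          fun z hz ↦ hmem σ hσ _ (e.map_source hz)
      exact (h1.continuousAt (e.open_source.mem_nhds hy)).congr
        (Filter.eventually_of_mem (e.open_source.mem_nhds hy) fun z hz ↦ (hF σ z hz).symm)
    · have hy' : y ∈ (e.symm '' D)ᶜ := by
        rintro ⟨d, hd, rfl⟩
        exact hy (e.map_target (hDe hd))
      refine continuousAt_id.congr
        (Filter.eventually_of_mem (hcl.isOpen_compl.mem_nhds hy') fun z hz ↦ ?_)
      by_cases hzs : z ∈ e.source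
      · rw [hF σ z hzs, hσ _ fun h ↦ hz ⟨e z, h, e.left_inv hzs⟩, e.left_inv hzs, id]
      · rw [hF' σ z hzs, id]
  have hinv : ∀ σ τ : Y ≃ₜ Y, (∀ y ∉ D, σ y = y) → (∀ y, τ (σ y) = y) →
      ∀ y, F τ (F σ y) = y := by
    intro σ τ hσ hτ y
    by_cases hy : y ∈ e.source
    · have h1 := hmem σ hσ _ (e.map_source hy)
      rw [hF σ y hy, hF τ _ (e.map_target h1), e.right_inv h1, hτ, e.left_inv hy]
    · rw [hF' σ y hy, hF' τ y hy]
  refine ⟨⟨⟨F θ, F θ.symm, hinv _ _ hθ θ.symm_apply_apply, hinv _ _ hsymm θ.apply_symm_apply⟩,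
    hcont _ hθ, hcont _ hsymm⟩, fun y hy ↦ ?_, fun y hy ↦ hF' θ y hy⟩
  have h1 := hmem θ hθ _ (e.map_source hy)
  change e (F θ y) = _ ∧ F θ y ∈ _
  rw [hF θ y hy]
  exact ⟨e.right_inv h1, e.map_target h1⟩

section TameImage

variable {n : ℕ}

/-- A compact totally disconnected subset of an axis is covered by disjoint small round balls. -/
theorem exists_disjoint_balls_cover_axis {C : Set (EuclideanSpace ℝ (Fin n))} (hC : IsCompact C)
    (htd : IsTotallyDisconnected C) {i : Fin n} (hi : ∀ x ∈ C, x = EuclideanSpace.single i (x i))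
    {δ : ℝ} (hδ : 0 < δ) :
    ∃ (J : Finset ℤ) (m : ℤ → EuclideanSpace ℝ (Fin n)) (r ρ : ℤ → ℝ),
      (∀ j, 0 < r j ∧ r j < ρ j ∧ ρ j ≤ δ) ∧
      Pairwise (Function.onFun Disjoint fun j ↦ ball (m j) (ρ j)) ∧
      (∀ x ∈ C, ∃ j ∈ J, x ∈ closedBall (m j) (r j)) ∧
      ∀ j ∈ J, (C ∩ ball (m j) (ρ j)).Nonempty := by
  classical
  have hgap : ∀ j : ℤ, ∃ t ∈ Ioo (j * δ) ((j + 1) * δ), EuclideanSpace.single i t ∉ C := by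
    intro j
    by_contra! h
    have hne : j * δ < (j + 1) * δ := by linarith
    obtain ⟨a, ha, b, hb, hab⟩ := (Ioo_infinite hne).nontrivial
    have h1 := htd _ (image_subset_iff.mpr h)
      (isPreconnected_Ioo.image _ (EuclideanSpace.continuous_single i).continuousOn)
    have h2 := congrArg (fun z : EuclideanSpace ℝ (Fin n) ↦ z i)
      (h1 (mem_image_of_mem _ ha) (mem_image_of_mem _ hb))
    simp at h2
    exact hab h2
  choose t ht htC using hgap
  have hstep : ∀ j, t j < (j + 1) * δ ∧ (j + 1) * δ < t (j + 1) := fun j ↦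
    ⟨(ht j).2, by simpa using (ht (j + 1)).1⟩
  have hmono : StrictMono t := strictMono_int_of_lt_succ fun j ↦ (hstep j).1.trans (hstep j).2
  let m : ℤ → EuclideanSpace ℝ (Fin n) := fun j ↦ EuclideanSpace.single i ((t j + t (j + 1)) / 2)
  let ρ : ℤ → ℝ := fun j ↦ (t (j + 1) - t j) / 2
  have hρ : ∀ j, 0 < ρ j := fun j ↦ by
    have := hmono (lt_add_one j)
    simp only [ρ]
    linarith
  have hdist : ∀ j, ∀ a, dist (EuclideanSpace.single i a) (m j) = |a - (t j + t (j + 1)) / 2| :=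
    fun j a ↦ (PiLp.dist_single_same 2 (fun _ ↦ ℝ) i a _).trans (Real.dist_eq _ _)
  have hcl : ∀ j, C ∩ closedBall (m j) (ρ j) ⊆ ball (m j) (ρ j) := by
    rintro j x ⟨hx, hxj⟩
    rw [mem_ball]
    refine lt_of_le_of_ne hxj fun h ↦ ?_
    rw [hi x hx, hdist] at h
    have hcase : x i = t j ∨ x i = t (j + 1) := by
      simp only [ρ] at h
      rcases abs_cases (x i - (t j + t (j + 1)) / 2) with h' | h'
      · right; linarith
      · left; linarith
    rcases hcase with h' | h'
    · exact htC j (h' ▸ hi x hx ▸ hx)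
    · exact htC (j + 1) (h' ▸ hi x hx ▸ hx)
  have hr : ∀ j, ∃ r ∈ Ioo 0 (ρ j), C ∩ closedBall (m j) (ρ j) ⊆ ball (m j) r := fun j ↦
    exists_pos_lt_subset_ball (hρ j) (hC.isClosed.inter isClosed_closedBall) (hcl j)
  choose r hr hrC using hr
  have hcov : ∀ x ∈ C, ∃ j, x ∈ ball (m j) (ρ j) := by
    intro x hx
    obtain ⟨k, hk1, hk2⟩ : ∃ k : ℤ, k * δ ≤ x i ∧ x i < (k + 1) * δ :=
      ⟨⌊x i / δ⌋, (le_div_iff₀ hδ).mp (Int.floor_le _),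
        (div_lt_iff₀ hδ).mp (Int.lt_floor_add_one _)⟩
    have hne : x i ≠ t k := fun h ↦ htC k (h ▸ hi x hx ▸ hx)
    have key : ∀ j, t j < x i → x i < t (j + 1) → x ∈ ball (m j) (ρ j) := fun j h1 h2 ↦ by
      rw [mem_ball, hi x hx, hdist, abs_lt]
      constructor <;> simp only [ρ] <;> linarith
    rcases lt_or_gt_of_ne hne with h | h
    · refine ⟨k - 1, key _ ?_ (by simpa using h)⟩
      have := (hstep (k - 1)).1
      push_cast at this
      linarith
    · exact ⟨k, key _ h (hk2.trans (hstep k).2)⟩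
  obtain ⟨J, hJ⟩ := hC.elim_finite_subcover (fun j ↦ ball (m j) (ρ j)) (fun j ↦ isOpen_ball)
    fun x hx ↦ mem_iUnion.mpr (hcov x hx)
  refine ⟨J.filter fun j ↦ (C ∩ ball (m j) (ρ j)).Nonempty, m, r, ρ,
    fun j ↦ ⟨(hr j).1, (hr j).2, ?_⟩, ?_, fun x hx ↦ ?_, fun j hj ↦ (Finset.mem_filter.mp hj).2⟩
  · have h1 := (ht j).1
    have h2 := (ht (j + 1)).2
    push_cast at h2
    simp only [ρ]
    linarith
  · refine (pairwise_disjoint_on _).mpr fun j k hjk ↦ ball_disjoint_ball ?_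
    rw [show m j = EuclideanSpace.single i _ from rfl, hdist]
    have := hmono.monotone (Int.add_one_le_iff.mpr hjk)
    refine le_trans ?_ (neg_le_abs _)
    simp only [ρ]
    linarith
  · obtain ⟨j, hj, hxj⟩ := mem_iUnion₂.mp (hJ hx)
    exact ⟨j, Finset.mem_filter.mpr ⟨hj, x, hx, hxj⟩,
      ball_subset_closedBall (hrC j ⟨hx, ball_subset_closedBall hxj⟩)⟩

/-- Infinite sets indexed by a finset have distinct representatives. -/
theorem Finset.exists_injOn_mem_of_infinite {ι α : Type*} [Nonempty α] (J : Finset ι)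
    (W : ι → Set α) (hW : ∀ j ∈ J, (W j).Infinite) :
    ∃ v : ι → α, InjOn v J ∧ ∀ j ∈ J, v j ∈ W j := by
  classical
  induction J using Finset.induction_on with
  | empty => exact ⟨fun _ ↦ Classical.arbitrary α, by simp⟩
  | insert a J ha ih =>
    obtain ⟨v, hv, hvW⟩ := ih fun j hj ↦ hW j (Finset.mem_insert_of_mem hj)
    obtain ⟨c, hc, hcJ⟩ := (hW a (Finset.mem_insert_self a J)).exists_notMem_finset (J.image v)
    have hne : ∀ j ∈ J, j ≠ a := fun j hj ↦ ne_of_mem_of_not_mem hj ha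
    have heq : EqOn (Function.update v a c) v J := fun j hj ↦
      Function.update_of_ne (hne j hj) c v
    refine ⟨Function.update v a c, ?_, fun j hj ↦ ?_⟩
    · rw [Finset.coe_insert, injOn_insert ha]
      refine ⟨heq.symm.injOn_iff.mp hv, ?_⟩
      rw [heq.image_eq, Function.update_self]
      simpa using hcJ
    · rcases Finset.mem_insert.mp hj with rfl | hj
      · rwa [Function.update_self]
      · rw [heq hj]
        exact hvW j hj

theorem exists_homeomorph_separating_coord
    (e : OpenPartialHomeomorph (EuclideanSpace ℝ (Fin n)) (EuclideanSpace ℝ (Fin n)))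
    {X : Set (EuclideanSpace ℝ (Fin n))} (hX : IsCompact X) (hXe : X ⊆ e.source)
    (htd : IsTotallyDisconnected (e '' X)) {i : Fin n}
    (hi : ∀ x ∈ X, e x = EuclideanSpace.single i (e x i))
    (f : EuclideanSpace ℝ (Fin n) ≃ₜ EuclideanSpace ℝ (Fin n)) (c : Fin n) {ε : ℝ} (hε : 0 < ε) :
    ∃ Θ : EuclideanSpace ℝ (Fin n) ≃ₜ EuclideanSpace ℝ (Fin n),
      (∀ y, dist (f (Θ y)) (f y) ≤ ε ∧ dist (Θ y) y ≤ ε) ∧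
      ∀ a ∈ X, ∀ b ∈ X, ε ≤ dist a b → f (Θ a) c ≠ f (Θ b) c := by
  set C := e '' X with hCdef
  have hC : IsCompact C := hX.image_of_continuousOn (e.continuousOn.mono hXe)
  have hCe : C ⊆ e.target := image_subset_iff.mpr fun x hx ↦ e.map_source (hXe hx)
  obtain ⟨δ₀, hδ₀, hT⟩ := hC.exists_cthickening_subset_open e.open_target hCe
  have hTc : IsCompact (cthickening δ₀ C) := hC.cthickening
  let G : EuclideanSpace ℝ (Fin n) → EuclideanSpace ℝ (Fin n) × EuclideanSpace ℝ (Fin n) :=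
    fun z ↦ (f (e.symm z), e.symm z)
  have hG : ContinuousOn G e.target :=
    (f.continuous.comp_continuousOn e.continuousOn_symm).prodMk e.continuousOn_symm
  obtain ⟨δ₁, hδ₁, hGu⟩ := Metric.uniformContinuousOn_iff.mp
    (hTc.uniformContinuousOn_of_continuous (hG.mono hT)) ε hε
  have hδ : 0 < min (δ₀ / 2) (δ₁ / 2) := by positivity
  obtain ⟨J, m, r, ρ, hrρ, hdisj, hcov, hmeet⟩ :=
    exists_disjoint_balls_cover_axis hC htd (i := i) (forall_mem_image.mpr hi) hδ
  have hρ₀ : ∀ j, 2 * ρ j ≤ δ₀ := fun j ↦ by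
    linarith [(hrρ j).2.2, min_le_left (δ₀ / 2) (δ₁ / 2)]
  have hρ₁ : ∀ j, 2 * ρ j ≤ δ₁ := fun j ↦ by
    linarith [(hrρ j).2.2, min_le_right (δ₀ / 2) (δ₁ / 2)]
  have hballT : ∀ j ∈ J, ball (m j) (ρ j) ⊆ cthickening δ₀ C := by
    intro j hj z hz
    obtain ⟨w, hw, hwj⟩ := hmeet j hj
    refine mem_cthickening_of_dist_le z w δ₀ C hw ?_
    have := dist_triangle_right z w (m j)
    rw [mem_ball] at hz hwj
    linarith [hρ₀ j]
  have hGball : ∀ j ∈ J, ∀ z ∈ ball (m j) (ρ j), ∀ w ∈ ball (m j) (ρ j), dist (G z) (G w) < ε := by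
    intro j hj z hz w hw
    refine hGu z (hballT j hj hz) w (hballT j hj hw) ?_
    have := dist_triangle_right z w (m j)
    rw [mem_ball] at hz hw
    linarith [hρ₁ j]
  let κ : ℤ → ℝ := fun j ↦ (ρ j - r j) / 3
  have hκ : ∀ j, 0 < κ j := fun j ↦ div_pos (sub_pos.mpr (hrρ j).2.1) three_pos
  have hκρ : ∀ j, κ j ≤ ρ j := fun j ↦ by
    have := (hrρ j).1
    have := (hrρ j).2.1
    simp only [κ]
    linarith
  let u : EuclideanSpace ℝ (Fin n) → ℝ := fun z ↦ (G z).1 c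
  have hopen : IsOpenMap fun z : EuclideanSpace ℝ (Fin n) ↦ z c :=
    (isOpenMap_eval c).comp (PiLp.homeomorph 2 fun _ : Fin n ↦ ℝ).isOpenMap
  have hinf : ∀ j ∈ J, (u '' ball (m j) (κ j)).Infinite := by
    intro j hj
    have hsub : ball (m j) (κ j) ⊆ e.symm.source :=
      ((ball_subset_ball (hκρ j)).trans (hballT j hj)).trans hT
    have h1 : IsOpen (e.symm '' ball (m j) (κ j)) :=
      e.symm.isOpen_image_of_subset_source isOpen_ball hsub
    have h2 : IsOpen (u '' ball (m j) (κ j)) := by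
      have := hopen _ (f.isOpenMap _ h1)
      rwa [image_image, image_image] at this
    exact infinite_of_mem_nhds (u (m j)) (h2.mem_nhds (mem_image_of_mem _ (mem_ball_self (hκ j))))
  obtain ⟨v, hvinj, hv⟩ := J.exists_injOn_mem_of_infinite _ hinf
  have hq : ∀ j, ∃ q, j ∈ J → q ∈ ball (m j) (κ j) ∧ u q = v j := by
    intro j
    by_cases hj : j ∈ J
    · obtain ⟨q, hq⟩ := hv j hj
      exact ⟨q, fun _ ↦ hq⟩
    · exact ⟨0, fun h ↦ absurd h hj⟩
  choose q hq using hq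
  obtain ⟨V, hV, hVdisj⟩ := (J.finite_toSet.image v).t2_separation
  have hη : ∀ j, ∃ η > 0, j ∈ J → ∀ z ∈ ball (q j) η, u z ∈ V (v j) := by
    intro j
    by_cases hj : j ∈ J
    · have hqt : q j ∈ e.target := hT (hballT j hj (ball_subset_ball (hκρ j) (hq j hj).1))
      have hu : ContinuousAt u (q j) :=
        ((by fun_prop : Continuous fun z : EuclideanSpace ℝ (Fin n) ↦ z c).continuousAt.comp
          (hG.continuousAt (e.open_target.mem_nhds hqt)).fst)
      have hnhds := hu.preimage_mem_nhds ((hV (u (q j))).2.mem_nhds (hV (u (q j))).1)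
      rw [(hq j hj).2] at hnhds
      obtain ⟨η, hη, h⟩ := Metric.mem_nhds_iff.mp hnhds
      exact ⟨η, hη, fun _ z hz ↦ h hz⟩
    · exact ⟨1, one_pos, fun h ↦ absurd h hj⟩
  choose η hη hηV using hη
  obtain ⟨θ, hθ1, hθ2, hθ3⟩ := exists_homeomorph_radial_shrink_finset J
    (fun j ↦ ball (m j) (ρ j)) (fun j _ k _ hjk ↦ hdisj hjk) q (fun j ↦ r j + κ j)
    (fun j ↦ ρ j - κ j) η (fun j _ ↦ (add_pos (hrρ j).1 (hκ j)).le)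
    (fun j _ ↦ by
      have := (hrρ j).2.1
      simp only [κ]
      linarith)
    (fun j _ ↦ hη j) (fun j hj ↦ ball_subset_ball' (by
      have := (hq j hj).1
      rw [mem_ball] at this
      linarith))
  obtain ⟨Θ, hΘ, hΘ'⟩ := exists_homeomorph_transport e θ hTc hT
    fun y hy ↦ hθ1 y fun j hj h ↦ hy (hballT j hj h)
  have hGe : ∀ y ∈ e.source, G (e y) = (f y, y) := fun y hy ↦ by simp only [G, e.left_inv hy]
  have hGΘ : ∀ y ∈ e.source, G (θ (e y)) = (f (Θ y), Θ y) := fun y hy ↦ by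
    rw [← (hΘ y hy).1, hGe _ (hΘ y hy).2]
  refine ⟨Θ, fun y ↦ ?_, fun a ha b hb hab heq ↦ ?_⟩
  · by_cases hy : y ∈ e.source
    · by_cases hyj : ∃ j ∈ J, e y ∈ ball (m j) (ρ j)
      · obtain ⟨j, hj, hyj⟩ := hyj
        have := (hGball j hj _ (hθ2 j hj _ hyj) _ hyj).le
        rw [hGe y hy, hGΘ y hy, Prod.dist_eq, max_le_iff] at this
        exact this
      · push Not at hyj
        have h1 := hGΘ y hy
        rw [hθ1 _ hyj, hGe y hy, Prod.mk_inj] at h1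
        rw [← h1.2]
        simp [hε.le]
    · simp [hΘ' y hy, hε.le]
  · obtain ⟨j, hj, haj⟩ := hcov (e a) (mem_image_of_mem e ha)
    obtain ⟨k, hk, hbk⟩ := hcov (e b) (mem_image_of_mem e hb)
    have key : ∀ j ∈ J, ∀ x ∈ X, e x ∈ closedBall (m j) (r j) → f (Θ x) c ∈ V (v j) := by
      intro j hj x hx hxj
      have h1 : e x ∈ closedBall (q j) (r j + κ j) := by
        refine closedBall_subset_closedBall' ?_ hxj
        have := (hq j hj).1
        rw [mem_ball'] at this
        linarith
      have h2 := hηV j hj _ (hθ3 j hj _ h1)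
      simpa only [u, hGΘ x (hXe hx)] using h2
    by_cases hjk : j = k
    · subst hjk
      have := hGball j hj (e a) (closedBall_subset_ball (hrρ j).2.1 haj) (e b)
        (closedBall_subset_ball (hrρ j).2.1 hbk)
      rw [hGe a (hXe ha), hGe b (hXe hb), Prod.dist_eq, max_lt_iff] at this
      exact absurd this.2 (not_lt.mpr hab)
    · exact disjoint_left.mp (hVdisj (mem_image_of_mem v hj) (mem_image_of_mem v hk)
        fun h ↦ hjk (hvinj hj hk h)) (key j hj a ha haj) (heq ▸ key k hk b hb hbk)

end TameImage

theorem exists_homeomorph_injOn_coord_of_chart {n : ℕ}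
    (e : OpenPartialHomeomorph (EuclideanSpace ℝ (Fin n)) (EuclideanSpace ℝ (Fin n)))
    {X : Set (EuclideanSpace ℝ (Fin n))} (hX : IsCompact X) (hXe : X ⊆ e.source)
    (htd : IsTotallyDisconnected (e '' X)) {i : Fin n}
    (hi : ∀ x ∈ X, e x = EuclideanSpace.single i (e x i)) (c : Fin n) :
    ∃ g : EuclideanSpace ℝ (Fin n) ≃ₜ EuclideanSpace ℝ (Fin n), InjOn (fun x ↦ g x c) X := by
  let M := C(EuclideanSpace ℝ (Fin n), EuclideanSpace ℝ (Fin n))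
  let H : Set (M × M) := {p | p.1.comp p.2 = .id _ ∧ p.2.comp p.1 = .id _}
  have hH : IsClosed H :=
    (isClosed_eq (continuous_fst.compCM continuous_snd) continuous_const).inter
      (isClosed_eq (continuous_snd.compCM continuous_fst) continuous_const)
  have : CompleteSpace H := hH.completeSpace_coe
  have : (uniformity H).IsCountablyGenerated := inferInstance
  let toHomeo : H → (EuclideanSpace ℝ (Fin n) ≃ₜ EuclideanSpace ℝ (Fin n)) := fun p ↦
    { toFun := p.1.1
      invFun := p.1.2
      left_inv := fun y ↦ congrArg (fun h : M ↦ h y) p.2.2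
      right_inv := fun y ↦ congrArg (fun h : M ↦ h y) p.2.1
      continuous_toFun := p.1.1.continuous
      continuous_invFun := p.1.2.continuous }
  let S : ℕ → Set (EuclideanSpace ℝ (Fin n) × EuclideanSpace ℝ (Fin n)) := fun k ↦
    (X ×ˢ X) ∩ {s | 1 / ((k : ℝ) + 1) ≤ dist s.1 s.2}
  have hS : ∀ k, IsCompact (S k) := fun k ↦
    (hX.prod hX).inter_right (isClosed_le continuous_const continuous_dist)
  let O : ℕ → Set H := fun k ↦ {p | ∀ s ∈ S k, p.1.1 s.1 c ≠ p.1.1 s.2 c}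
  have hO : ∀ k, IsOpen (O k) := by
    intro k
    rw [isOpen_iff_eventually]
    intro p hp
    refine (hS k).eventually_forall_of_forall_eventually fun s hs ↦ ?_
    have hc : ∀ φ : EuclideanSpace ℝ (Fin n) × EuclideanSpace ℝ (Fin n) →
        EuclideanSpace ℝ (Fin n), Continuous φ → Continuous
          fun z : H × (EuclideanSpace ℝ (Fin n) × EuclideanSpace ℝ (Fin n)) ↦ z.1.1.1 (φ z.2) c :=
      fun φ hφ ↦ by fun_prop
    exact (isOpen_ne_fun (hc _ continuous_fst) (hc _ continuous_snd)).mem_nhds (hp s hs)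
  have hd : ∀ k, Dense (O k) := by
    intro k p
    have hε : ∀ l : ℕ, 0 < min (1 / ((l : ℝ) + 1)) (1 / ((k : ℝ) + 1)) := fun l ↦ by positivity
    choose Θ hΘ hsep using fun l : ℕ ↦
      exists_homeomorph_separating_coord e hX hXe htd hi (toHomeo p) c (hε l)
    let g : ℕ → H := fun l ↦ ⟨(((Θ l).trans (toHomeo p) : C(_, _)),
      ((Θ l).trans (toHomeo p)).symm), by
        constructor <;> ext1 y <;> simp⟩
    refine mem_closure_of_tendsto (f := g) (b := Filter.atTop) ?_
      (Filter.Eventually.of_forall fun l s hs ↦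
        hsep l _ hs.1.1 _ hs.1.2 ((min_le_right _ _).trans hs.2))
    have hlim : ∀ ε > (0 : ℝ), ∀ᶠ l : ℕ in Filter.atTop, 1 / ((l : ℝ) + 1) < ε := fun ε hε ↦
      tendsto_one_div_add_atTop_nhds_zero_nat.eventually (gt_mem_nhds hε)
    rw [tendsto_subtype_rng]
    refine Filter.Tendsto.prodMk_nhds ?_ ?_ <;>
      refine ContinuousMap.tendsto_of_tendstoLocallyUniformly
        (Metric.tendstoUniformly_iff.mpr fun ε hε ↦ ?_).tendstoLocallyUniformly <;>
      filter_upwards [hlim ε hε] with l hl y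
    · rw [dist_comm]
      exact ((hΘ l y).1.trans (min_le_left _ _)).trans_lt hl
    · have := ((hΘ l ((Θ l).symm ((toHomeo p).symm y))).2.trans (min_le_left _ _)).trans_lt hl
      rw [Homeomorph.apply_symm_apply] at this
      exact this
  obtain ⟨p, hp⟩ := (dense_iInter_of_isOpen_nat hO hd).nonempty_iff.mpr
    ⟨⟨(.id _, .id _), rfl, rfl⟩⟩
  refine ⟨toHomeo p, fun a ha b hb hab ↦ ?_⟩
  by_contra hne
  obtain ⟨k, hk⟩ := exists_nat_one_div_lt (dist_pos.mpr hne)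
  exact mem_iInter.mp hp k (a, b) ⟨⟨ha, hb⟩, hk.le⟩ hab

theorem IsTotallyDisconnected.image_openPartialHomeomorph {X Y : Type*} [TopologicalSpace X]
    [TopologicalSpace Y] {s : Set X} (hs : IsTotallyDisconnected s)
    (e : OpenPartialHomeomorph X Y) (hse : s ⊆ e.source) : IsTotallyDisconnected (e '' s) := by
  intro t ht hp x hx y hy
  have hte : t ⊆ e.target :=
    ht.trans (image_subset_iff.mpr fun z hz ↦ e.map_source (hse hz))
  have hsub : e.symm '' t ⊆ s := by
    rintro _ ⟨z, hz, rfl⟩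
    obtain ⟨w, hw, rfl⟩ := ht hz
    rwa [e.left_inv (hse hw)]
  exact e.symm.injOn (hte hx) (hte hy) (hs _ hsub (hp.image _ (e.continuousOn_symm.mono hte))
    (mem_image_of_mem _ hx) (mem_image_of_mem _ hy))

/-- A compact totally disconnected set in the domain of a chart which flattens it into
a coordinate hyperplane can be moved into an axis by a global homeomorphism. -/
theorem exists_homeomorph_image_subset_axis_of_chart {n : ℕ}
    (e : OpenPartialHomeomorph (EuclideanSpace ℝ (Fin n)) (EuclideanSpace ℝ (Fin n)))
    {X : Set (EuclideanSpace ℝ (Fin n))} (hX : IsCompact X) (hXe : X ⊆ e.source)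
    (htd : IsTotallyDisconnected X) {i : Fin n} (hi : ∀ x ∈ X, e x i = 0) (c : Fin n) :
    ∃ g : EuclideanSpace ℝ (Fin n) ≃ₜ EuclideanSpace ℝ (Fin n),
      ∀ x ∈ X, ∃ t, g x = EuclideanSpace.single c t := by
  have hL : IsCompact (e '' X) := hX.image_of_continuousOn (e.continuousOn.mono hXe)
  obtain ⟨h, hh⟩ := exists_homeomorph_injOn_coord hL (htd.image_openPartialHomeomorph e hXe)
    (forall_mem_image.mpr hi)
  obtain ⟨k, hk⟩ := exists_homeomorph_image_subset_axis (hL.image h.continuous) (i := i)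
    (by rintro _ ⟨a, ha, rfl⟩ _ ⟨b, hb, rfl⟩ hab; exact congrArg h (hh ha hb hab))
  obtain ⟨f, hf⟩ := exists_homeomorph_injOn_coord_of_chart (e.transHomeomorph (h.trans k)) hX hXe
    (htd.image_openPartialHomeomorph _ hXe) (i := i) (fun x hx ↦ by
      have := hk (h (e x)) (mem_image_of_mem h (mem_image_of_mem e hx))
      simp [this]) c
  obtain ⟨g, hg⟩ := exists_homeomorph_image_subset_axis (hX.image f.continuous) (i := c)
    (by rintro _ ⟨a, ha, rfl⟩ _ ⟨b, hb, rfl⟩ hab; exact congrArg f (hf ha hb hab))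
  exact ⟨f.trans g, fun x hx ↦ ⟨_, hg (f x) (mem_image_of_mem f hx)⟩⟩

/-- A continuous injection on an open set is the restriction of a chart. -/
theorem exists_openPartialHomeomorph_of_continuousOn_injOn {E : Type*} [NormedAddCommGroup E]
    [InnerProductSpace ℝ E] [FiniteDimensional ℝ E] {s : Set E} (hs : IsOpen s) {f : E → E}
    (hf : ContinuousOn f s) (hinj : InjOn f s) :
    ∃ e : OpenPartialHomeomorph E E, e.source = s ∧ ⇑e = f := by
  refine ⟨OpenPartialHomeomorph.ofContinuousOpenRestrict hinj.toPartialEquiv hf ?_ hs, rfl, rfl⟩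
  intro (t : Set s) ht
  have hsub : Subtype.val '' t ⊆ s := by
    rintro _ ⟨z, -, rfl⟩
    exact z.2
  have := (hs.isOpenMap_subtype_val t ht).isOpen_image_of_continuousOn_of_injOn
    (hf.mono hsub) (hinj.mono hsub)
  rw [image_image] at this
  exact this

theorem LocallyTameAt.locallyHyperplanarAt {n : ℕ} (hn : 3 ≤ n)
    {K : Set (EuclideanSpace ℝ (Fin n))} {x : EuclideanSpace ℝ (Fin n)} (h : LocallyTameAt K x) :
    LocallyHyperplanarAt K x := by
  obtain ⟨U, hU, g, hg⟩ := h
  refine ⟨U, hU, fun y ↦ g y, g.isEmbedding.comp .subtypeVal, fun y hy i hi ↦ ?_⟩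
  exact hg (mem_image_of_mem g ⟨hy, subset_closure y.2⟩) i (by omega)

theorem LocallyHyperplanarAt.locallyTameAt {n : ℕ} (hn : 3 ≤ n)
    {K : Set (EuclideanSpace ℝ (Fin n))} (hcpt : IsCompact K) (htd : IsTotallyDisconnected K)
    {x : EuclideanSpace ℝ (Fin n)} (h : LocallyHyperplanarAt K x) : LocallyTameAt K x := by
  classical
  obtain ⟨U, hU, h, hemb, hK⟩ := h
  obtain ⟨r, hr, hrU⟩ := Metric.mem_nhds_iff.mp hU
  let f : EuclideanSpace ℝ (Fin n) → EuclideanSpace ℝ (Fin n) := fun y ↦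
    if hy : y ∈ U then h ⟨y, hy⟩ else 0
  have hf : ∀ y (hy : y ∈ U), f y = h ⟨y, hy⟩ := fun y hy ↦ dif_pos hy
  have hfc : ContinuousOn f U := by
    rw [continuousOn_iff_continuous_domRestrict]
    convert hemb.continuous using 1
    ext1 y
    exact hf y y.2
  have hfi : InjOn f U := fun y hy z hz hyz ↦ by
    rw [hf y hy, hf z hz] at hyz
    exact congrArg Subtype.val (hemb.injective hyz)
  obtain ⟨e, hes, hef⟩ := exists_openPartialHomeomorph_of_continuousOn_injOn
    (isOpen_ball : IsOpen (ball x r)) (hfc.mono hrU) (hfi.mono hrU)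
  have hsub : K ∩ closure (closedBall x (r / 2)) ⊆ ball x r := by
    rw [isClosed_closedBall.closure_eq]
    exact inter_subset_right.trans (closedBall_subset_ball (half_lt_self hr))
  obtain ⟨g, hg⟩ := exists_homeomorph_image_subset_axis_of_chart e
    (hcpt.inter_right isClosed_closure) (hes ▸ hsub) (fun t ht ↦ htd t (ht.trans inter_subset_left))
    (i := ⟨n - 1, by omega⟩)
    (fun y hy ↦ by
      rw [hef, hf y (hrU (hsub hy))]
      exact hK ⟨y, _⟩ hy.1 _ rfl) ⟨0, by omega⟩
  refine ⟨closedBall x (r / 2), closedBall_mem_nhds x (half_pos hr), g, ?_⟩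
  rintro _ ⟨y, hy, rfl⟩ i hi
  obtain ⟨t, ht⟩ := hg y hy
  rw [ht]
  simp [Fin.ext_iff, hi]

/-- **Statement 2.3 (Frolkina).** For `n ≥ 3`, a compact totally disconnected `K ⊆ ℝⁿ` is
locally wild at `x ∈ K` iff `K` is not locally hyperplanar at `x`. -/
theorem locallyWild_iff_not_locallyHyperplanar (n : ℕ) (hn : 3 ≤ n)
    (K : Set (EuclideanSpace ℝ (Fin n))) (hcpt : IsCompact K)
    (htd : IsTotallyDisconnected K)
    (x : EuclideanSpace ℝ (Fin n)) (hx : x ∈ K) :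
    (¬ LocallyTameAt K x) ↔ ¬ LocallyHyperplanarAt K x := by
  exact not_congr ⟨fun h ↦ h.locallyHyperplanarAt hn, fun h ↦ h.locallyTameAt hn hcpt htd⟩

end
end

section
/- If a Cantor set K ⊆ ℝⁿ is a union of countably many tame compact sets K₁, K₂, …, then K is tame. -/
open Set Topology Metric

noncomputable section

/-- A Lipschitz perturbation of the identity with constant less than `1` is a homeomorphism. -/
theorem exists_homeomorph_id_sub {E : Type*} [NormedAddCommGroup E] [NormedSpace ℝ E]
    [CompleteSpace E] {u : E → E} {c : NNReal} (hu : LipschitzWith c u) (hc : c < 1) :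
    ∃ g : E ≃ₜ E, ∀ x, g x = x - u x := by
  have h : ApproximatesLinearOn (fun x => x - u x)
      ((ContinuousLinearEquiv.refl ℝ E : E ≃L[ℝ] E) : E →L[ℝ] E) univ c := by
    intro x _ y _
    have h := hu.dist_le_mul x y
    rw [dist_eq_norm, dist_eq_norm] at h
    have h' : x - u x - (y - u y) -
        ((ContinuousLinearEquiv.refl ℝ E : E ≃L[ℝ] E) : E →L[ℝ] E) (x - y) = -(u x - u y) := by
      simp only [ContinuousLinearEquiv.coe_coe, ContinuousLinearEquiv.coe_refl']
      simp only [id_eq]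
      abel
    rw [h', norm_neg]
    exact h
  refine ⟨h.toHomeomorph _ ?_, fun x => rfl⟩
  rcases subsingleton_or_nontrivial E with hE | hE
  · exact Or.inl hE
  · right
    have : ‖(((ContinuousLinearEquiv.refl ℝ E : E ≃L[ℝ] E).symm : E ≃L[ℝ] E) : E →L[ℝ] E)‖₊ = 1 :=
      NNReal.eq ContinuousLinearMap.norm_id
    rw [this, inv_one]
    exact hc

/-- A homeomorphism which contracts finitely many disjoint balls towards their centres and is the
identity elsewhere. -/
theorem exists_homeomorph_contract {E ι : Type*} [NormedAddCommGroup E] [NormedSpace ℝ E]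
    [FiniteDimensional ℝ E] (J : Finset ι) (p : ι → E) (s R : ι → ℝ)
    (hs : ∀ j ∈ J, 0 < s j) (hsR : ∀ j ∈ J, s j < R j)
    (hdisj : ∀ i ∈ J, ∀ j ∈ J, i ≠ j → Disjoint (ball (p i) (R i)) (ball (p j) (R j))) :
    ∃ (g : E ≃ₜ E) (a : ℝ), 0 ≤ a ∧ a < 1 ∧
      (∀ y, (∀ j ∈ J, y ∉ ball (p j) (R j)) → g y = y) ∧
      (∀ j ∈ J, ∀ y ∈ ball (p j) (R j), dist (g y) (p j) ≤ dist y (p j)) ∧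
      ∀ j ∈ J, ∀ y ∈ closedBall (p j) (s j), dist (g y) (p j) ≤ a * dist y (p j) := by
  classical
  have hex : ∀ j, ∃ χ : E → ℝ, j ∈ J → ContDiff ℝ 1 χ ∧ HasCompactSupport χ ∧
      (∀ y, 0 ≤ χ y ∧ χ y ≤ 1) ∧ (∀ y ∉ ball (p j) (R j), χ y = 0) ∧
      ∀ y ∈ closedBall (p j) (s j), χ y = 1 := by
    intro j
    by_cases hj : j ∈ J
    · let χ : ContDiffBump (p j) := ⟨s j, R j, hs j hj, hsR j hj⟩
      refine ⟨χ, fun _ => ⟨χ.contDiff, χ.hasCompactSupport, fun y => ⟨χ.nonneg, χ.le_one⟩,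
        fun y hy => ?_, fun y hy => χ.one_of_mem_closedBall hy⟩⟩
      have : y ∉ Function.support χ := by rwa [χ.support_eq]
      simpa using this
    · exact ⟨0, fun h => absurd h hj⟩
  choose χ hχ using hex
  set u : E → E := fun x => ∑ j ∈ J, χ j x • (x - p j) with hu
  have hu_smooth : ContDiff ℝ 1 u :=
    ContDiff.sum fun j hj => (hχ j hj).1.smul (contDiff_id.sub contDiff_const)
  have hu_supp : HasCompactSupport u := by
    have : IsCompact (⋃ j ∈ J, tsupport (χ j)) :=
      J.isCompact_biUnion fun j hj => (hχ j hj).2.1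
    refine HasCompactSupport.intro this fun x hx => Finset.sum_eq_zero fun j hj => ?_
    have : x ∉ tsupport (χ j) := fun h => hx (mem_biUnion hj h)
    rw [image_eq_zero_of_notMem_tsupport this, zero_smul]
  obtain ⟨C, hC⟩ := hu_smooth.lipschitzWith_of_hasCompactSupport hu_supp one_ne_zero
  set c : NNReal := (C + 2)⁻¹ with hc
  have hc0 : 0 < c := by positivity
  have hc1 : (c : ℝ) < 1 := by
    rw [hc]
    push_cast
    refine inv_lt_one_of_one_lt₀ ?_
    linarith [C.coe_nonneg]
  have hcC : c * C < 1 := by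
    rw [hc, inv_mul_lt_iff₀ (by positivity), mul_one]
    exact lt_add_of_pos_right _ two_pos
  have hlip : LipschitzWith (c * C) fun x => (c : ℝ) • u x := by
    refine LipschitzWith.of_dist_le_mul fun x y => ?_
    rw [dist_smul₀, NNReal.coe_mul, mul_assoc, Real.norm_of_nonneg c.coe_nonneg]
    exact mul_le_mul_of_nonneg_left (hC.dist_le_mul x y) c.coe_nonneg
  obtain ⟨g, hg⟩ := exists_homeomorph_id_sub hlip hcC
  have hball : ∀ j ∈ J, ∀ y ∈ ball (p j) (R j),
      g y - p j = (1 - c * χ j y) • (y - p j) := by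
    intro j hj y hy
    have : u y = χ j y • (y - p j) := by
      refine Finset.sum_eq_single_of_mem j hj fun i hi hij => ?_
      rw [(hχ i hi).2.2.2.1 y fun h => (hdisj i hi j hj hij).le_bot ⟨h, hy⟩, zero_smul]
    rw [hg, this, sub_smul, one_smul, mul_smul]
    abel
  refine ⟨g, 1 - c, by linarith, by linarith [NNReal.coe_pos.2 hc0], fun y hy => ?_,
    fun j hj y hy => ?_, fun j hj y hy => ?_⟩
  · rw [hg, hu]
    simp only
    rw [Finset.sum_eq_zero fun j hj => by rw [(hχ j hj).2.2.2.1 y (hy j hj), zero_smul], smul_zero,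
      sub_zero]
  · obtain ⟨h0, h1⟩ := (hχ j hj).2.2.1 y
    have h2 : 0 ≤ (c : ℝ) * χ j y := mul_nonneg c.coe_nonneg h0
    have h3 : (c : ℝ) * χ j y ≤ 1 := mul_le_one₀ hc1.le h0 h1
    rw [dist_eq_norm, hball j hj y hy, norm_smul, Real.norm_of_nonneg (by linarith), dist_eq_norm]
    exact mul_le_of_le_one_left (norm_nonneg _) (by linarith)
  · have hy' : y ∈ ball (p j) (R j) := closedBall_subset_ball (hsR j hj) hy
    rw [dist_eq_norm, hball j hj y hy', norm_smul, (hχ j hj).2.2.2.2 y hy, mul_one,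
      Real.norm_of_nonneg (by linarith), dist_eq_norm]

/-- Finitely many closed balls can be shrunk arbitrarily close to their centres by a homeomorphism
supported in given disjoint larger balls. -/
theorem exists_homeomorph_shrink {E ι : Type*} [NormedAddCommGroup E] [NormedSpace ℝ E]
    [FiniteDimensional ℝ E] (J : Finset ι) (p : ι → E) (s R η : ι → ℝ)
    (hs : ∀ j ∈ J, 0 < s j) (hsR : ∀ j ∈ J, s j < R j) (hη : ∀ j ∈ J, 0 < η j)
    (hdisj : ∀ i ∈ J, ∀ j ∈ J, i ≠ j → Disjoint (ball (p i) (R i)) (ball (p j) (R j))) :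
    ∃ g : E ≃ₜ E,
      (∀ y, g y = y ∨ ∃ j ∈ J, y ∈ ball (p j) (R j) ∧ g y ∈ ball (p j) (R j)) ∧
      ∀ j ∈ J, ∀ y ∈ closedBall (p j) (s j), g y ∈ ball (p j) (η j) := by
  obtain ⟨g, a, ha0, ha1, hfix, hle, hcon⟩ := exists_homeomorph_contract J p s R hs hsR hdisj
  have hiter : ∀ k : ℕ, ∃ G : E ≃ₜ E,
      (∀ y, (∀ j ∈ J, y ∉ ball (p j) (R j)) → G y = y) ∧
      (∀ j ∈ J, ∀ y ∈ ball (p j) (R j), G y ∈ ball (p j) (R j)) ∧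
      ∀ j ∈ J, ∀ y ∈ closedBall (p j) (s j), dist (G y) (p j) ≤ a ^ k * s j := by
    intro k
    induction k with
    | zero =>
      exact ⟨Homeomorph.refl E, fun _ _ => rfl, fun _ _ _ h => h,
        fun j _ y hy => by simpa using hy⟩
    | succ k ih =>
      obtain ⟨G, h1, h2, h3⟩ := ih
      refine ⟨G.trans g, fun y hy => ?_, fun j hj y hy => ?_, fun j hj y hy => ?_⟩
      · rw [Homeomorph.trans_apply, h1 y hy, hfix y hy]
      · have := h2 j hj y hy
        exact (hle j hj (G y) this).trans_lt this
      · have h4 := h3 j hj y hy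
        have h5 : G y ∈ closedBall (p j) (s j) :=
          h4.trans (mul_le_of_le_one_left (hs j hj).le (pow_le_one₀ ha0 ha1.le))
        calc dist (g (G y)) (p j) ≤ a * dist (G y) (p j) := hcon j hj _ h5
          _ ≤ a * (a ^ k * s j) := mul_le_mul_of_nonneg_left h4 ha0
          _ = a ^ (k + 1) * s j := by ring
  have hlim : ∀ᶠ k : ℕ in Filter.atTop, ∀ j ∈ J, a ^ k * s j < η j := by
    rw [Filter.eventually_all_finset]
    intro j hj
    have : Filter.Tendsto (fun k : ℕ => a ^ k * s j) Filter.atTop (𝓝 (0 * s j)) :=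
      (tendsto_pow_atTop_nhds_zero_of_lt_one ha0 ha1).mul_const _
    rw [zero_mul] at this
    exact this.eventually_lt_const (hη j hj)
  obtain ⟨k, hk⟩ := hlim.exists
  obtain ⟨G, h1, h2, h3⟩ := hiter k
  refine ⟨G, fun y => ?_, fun j hj y hy => (h3 j hj y hy).trans_lt (hk j hj)⟩
  by_cases h : ∃ j ∈ J, y ∈ ball (p j) (R j)
  · obtain ⟨j, hj, hy⟩ := h
    exact Or.inr ⟨j, hj, hy, h2 j hj y hy⟩
  · push Not at h
    exact Or.inl (h1 y h)

/-- A totally disconnected compact subset of the coordinate line is covered by finitely many small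
disjoint balls whose boundaries miss it. -/
theorem exists_cover_of_subset_coordLine {n : ℕ} {T : Set (EuclideanSpace ℝ (Fin (n + 1)))}
    (hT : IsCompact T) (hTd : IsTotallyDisconnected T) (hTl : T ⊆ coordLine (n + 1))
    {δ : ℝ} (hδ : 0 < δ) :
    ∃ (J : Finset ℤ) (p : ℤ → EuclideanSpace ℝ (Fin (n + 1))) (r : ℤ → ℝ),
      (∀ j, 0 < r j ∧ r j < δ) ∧
      (∀ i j, i ≠ j → r i + r j ≤ dist (p i) (p j)) ∧
      (∀ x ∈ T, ∃ j ∈ J, dist x (p j) < r j) ∧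
      (∀ x ∈ T, ∀ j, dist x (p j) ≠ r j) ∧
      ∀ j ∈ J, ∃ x ∈ T, dist x (p j) < r j := by
  classical
  set e : ℝ → EuclideanSpace ℝ (Fin (n + 1)) := fun t => EuclideanSpace.single 0 t with he
  have hdist : ∀ s t, dist (e s) (e t) = |s - t| := fun s t => by
    rw [he, PiLp.dist_single_same, Real.dist_eq]
  have hiso : Isometry e := Isometry.of_dist_eq fun s t => by rw [hdist, Real.dist_eq]
  have hline : ∀ x ∈ T, x = e (x 0) := by
    intro x hx
    ext i
    by_cases hi : i = 0
    · subst hi; simp [he]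
    · have h0 := hTl hx i fun h => hi (Fin.ext h)
      simp [he, hi, h0]
  have hgap : ∀ a b : ℝ, a < b → ∃ t ∈ Ioo a b, e t ∉ T := by
    intro a b hab
    by_contra! h
    have hsub := hTd (e '' Ioo a b) (image_subset_iff.2 h)
      (isPreconnected_Ioo.image e hiso.continuous.continuousOn)
    have hss : (Ioo a b).Subsingleton :=
      fun x hx y hy => hiso.injective (hsub (mem_image_of_mem e hx) (mem_image_of_mem e hy))
    have h1 : a + (b - a) / 3 = a + (b - a) / 2 :=
      hss ⟨by linarith, by linarith⟩ ⟨by linarith, by linarith⟩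
    linarith
  choose c hcI hcT using fun k : ℤ => hgap (k * δ) ((k + 1) * δ) (by linarith)
  have hstep : ∀ k : ℤ, c k < c (k + 1) := fun k => by
    have h1 := (hcI k).2
    have h2 := (hcI (k + 1)).1
    push_cast at h2
    linarith
  have hmono : Monotone c := monotone_int_of_le_succ fun k => (hstep k).le
  set t : ℤ → ℝ := fun k => (c k + c (k + 1)) / 2 with ht
  set r : ℤ → ℝ := fun k => (c (k + 1) - c k) / 2 with hr
  have hcov : ∀ x ∈ T, ∃ j, dist x (e (t j)) < r j := by
    intro x hx
    have key : ∀ k, c k < x 0 → x 0 < c (k + 1) → ∃ j, dist x (e (t j)) < r j := by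
      intro k h1 h2
      refine ⟨k, ?_⟩
      rw [hline x hx, hdist, abs_lt]
      simp only [ht, hr]
      constructor <;> linarith
    set k := ⌊x 0 / δ⌋ with hk
    have h1 : (k : ℝ) * δ ≤ x 0 := (le_div_iff₀ hδ).1 (Int.floor_le _)
    have h2 : x 0 < (k + 1) * δ := (div_lt_iff₀ hδ).1 (Int.lt_floor_add_one _)
    rcases lt_trichotomy (c k) (x 0) with h | h | h
    · refine key k h (h2.trans ?_)
      have := (hcI (k + 1)).1
      push_cast at this
      exact this
    · refine absurd ?_ (hcT k)
      rw [h, ← hline x hx]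
      exact hx
    · refine key (k - 1) (lt_of_lt_of_le ?_ h1) (by simpa using h)
      have := (hcI (k - 1)).2
      push_cast at this
      simpa using this
  obtain ⟨J, hJ⟩ := hT.elim_finite_subcover (fun j => ball (e (t j)) (r j))
    (fun j => isOpen_ball) fun x hx => mem_iUnion.2 (hcov x hx)
  refine ⟨J.filter fun j => ∃ x ∈ T, dist x (e (t j)) < r j, fun j => e (t j), r, fun j => ?_,
    fun i j hij => ?_, fun x hx => ?_, fun x hx j h => ?_, fun j hj => (Finset.mem_filter.1 hj).2⟩
  · have h1 := (hcI j).1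
    have h2 := (hcI (j + 1)).2
    have h3 := hstep j
    push_cast at h2
    simp only [hr]
    constructor <;> linarith
  · have key : ∀ i j, i < j → r i + r j ≤ dist (e (t i)) (e (t j)) := by
      intro i j h
      have h1 : c (i + 1) ≤ c j := hmono h
      rw [hdist, abs_sub_comm]
      refine le_trans ?_ (le_abs_self _)
      simp only [ht, hr]
      linarith
    rcases lt_or_gt_of_ne hij with h | h
    · exact key i j h
    · rw [add_comm, dist_comm]
      exact key j i h
  · obtain ⟨j, hj, hxj⟩ := mem_iUnion₂.1 (hJ hx)
    exact ⟨j, Finset.mem_filter.2 ⟨hj, x, hx, hxj⟩, hxj⟩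
  · have hxe := hline x hx
    rw [hxe, hdist] at h
    simp only [ht, hr] at h
    rcases (abs_eq (by linarith [hstep j])).1 h with h | h
    · refine hcT (j + 1) ?_
      rwa [show c (j + 1) = x 0 by linarith, ← hxe]
    · refine hcT j ?_
      rwa [show c j = x 0 by linarith, ← hxe]

/-- A totally disconnected compact subset of the coordinate line can be pushed into any dense open
set by a homeomorphism which is arbitrarily close to the identity. -/
theorem exists_push_of_subset_coordLine {n : ℕ} {T : Set (EuclideanSpace ℝ (Fin (n + 1)))}
    (hT : IsCompact T) (hTd : IsTotallyDisconnected T) (hTl : T ⊆ coordLine (n + 1))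
    {D : Set (EuclideanSpace ℝ (Fin (n + 1)))} (hDo : IsOpen D) (hDd : Dense D)
    (N : EuclideanSpace ℝ (Fin (n + 1)) → Set (EuclideanSpace ℝ (Fin (n + 1))))
    (hNo : ∀ x, IsOpen (N x)) (hN : ∀ x ∈ T, x ∈ N x) :
    ∃ g : EuclideanSpace ℝ (Fin (n + 1)) ≃ₜ EuclideanSpace ℝ (Fin (n + 1)),
      (∀ y, g y = y ∨ ∃ x ∈ T, y ∈ N x ∧ g y ∈ N x) ∧ ∀ x ∈ T, g x ∈ D := by
  classical
  obtain ⟨δ, hδ, hleb⟩ := lebesgue_number_lemma_of_metric (c := fun x : T => N x) hT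
    (fun x => hNo x) fun x hx => mem_iUnion.2 ⟨⟨x, hx⟩, hN x hx⟩
  obtain ⟨J, p, r, hr, hdisj, hcov, hbd, hmeet⟩ :=
    exists_cover_of_subset_coordLine hT hTd hTl (half_pos hδ)
  have hs : ∀ j, ∃ s, 0 < s ∧ s < r j ∧ ∀ x ∈ T, dist x (p j) < r j → dist x (p j) ≤ s := by
    intro j
    have hc : IsCompact (T ∩ closedBall (p j) (r j)) := hT.inter_right isClosed_closedBall
    rcases (T ∩ closedBall (p j) (r j)).eq_empty_or_nonempty with h | h
    · refine ⟨r j / 2, half_pos (hr j).1, half_lt_self (hr j).1, fun x hx hxr => ?_⟩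
      exact absurd (show x ∈ T ∩ closedBall (p j) (r j) from ⟨hx, hxr.le⟩) (by simp [h])
    · obtain ⟨x, hx, hmax⟩ := hc.exists_isMaxOn h
        (continuous_id.dist continuous_const : Continuous fun x => dist x (p j)).continuousOn
      have hxr : dist x (p j) < r j := lt_of_le_of_ne hx.2 (hbd x hx.1 j)
      refine ⟨max (dist x (p j)) (r j / 2), lt_max_of_lt_right (half_pos (hr j).1),
        max_lt hxr (half_lt_self (hr j).1), fun y hy hyr => le_max_of_le_left ?_⟩
      exact hmax (show y ∈ T ∩ closedBall (p j) (r j) from ⟨hy, hyr.le⟩)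
  choose s hs0 hsr hsT using hs
  have hq : ∀ j, ∃ q ∈ D, dist q (p j) < (r j - s j) / 3 := fun j => by
    obtain ⟨q, hq, hqD⟩ := hDd.exists_dist_lt (p j) (show 0 < (r j - s j) / 3 by linarith [hsr j])
    exact ⟨q, hq, by rwa [dist_comm]⟩
  choose q hqD hqp using hq
  choose η hη hηD using fun j => Metric.isOpen_iff.1 hDo (q j) (hqD j)
  have hqd : ∀ j y, dist y (q j) < s j + 2 * ((r j - s j) / 3) → dist y (p j) < r j := by
    intro j y hy
    have h1 := dist_triangle y (q j) (p j)
    have h2 := hqp j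
    linarith
  have hballs : ∀ i ∈ J, ∀ j ∈ J, i ≠ j →
      Disjoint (ball (q i) (s i + 2 * ((r i - s i) / 3)))
        (ball (q j) (s j + 2 * ((r j - s j) / 3))) := by
    intro i _ j _ hij
    rw [Set.disjoint_left]
    intro y hyi hyj
    have h1 := hqd i y hyi
    have h2 := hqd j y hyj
    have h3 := dist_triangle_left (p i) (p j) y
    linarith [hdisj i j hij]
  obtain ⟨g, hg1, hg2⟩ := exists_homeomorph_shrink J q (fun j => s j + (r j - s j) / 3)
    (fun j => s j + 2 * ((r j - s j) / 3)) η
    (fun j _ => by linarith [hs0 j, hsr j]) (fun j _ => by linarith [hs0 j, hsr j])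
    (fun j _ => hη j) hballs
  refine ⟨g, fun y => ?_, fun x hx => ?_⟩
  · refine (hg1 y).imp_right ?_
    rintro ⟨j, hj, hy, hgy⟩
    obtain ⟨x, hx, hxj⟩ := hmeet j hj
    obtain ⟨z, hz⟩ := hleb x hx
    have key : ∀ y, dist y (p j) < r j → y ∈ N z := fun y hy => hz <| by
      have := dist_triangle_right y x (p j)
      rw [mem_ball]
      linarith [(hr j).2]
    exact ⟨z, z.2, key y (hqd j y hy), key _ (hqd j _ hgy)⟩
  · obtain ⟨j, hj, hxj⟩ := hcov x hx
    refine hηD j (hg2 j hj x ?_)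
    have h1 := hsT j x hx hxj
    have h2 := dist_triangle_right x (q j) (p j)
    rw [mem_closedBall]
    linarith [hqp j]

/-- A totally disconnected tame compact set can be pushed into any dense open set by a
homeomorphism which is arbitrarily close to the identity. -/
theorem TameSet.exists_push {n : ℕ} {T : Set (EuclideanSpace ℝ (Fin (n + 1)))}
    (htame : TameSet T) (hT : IsCompact T) (hTd : IsTotallyDisconnected T)
    {D : Set (EuclideanSpace ℝ (Fin (n + 1)))} (hDo : IsOpen D) (hDd : Dense D)
    (N : EuclideanSpace ℝ (Fin (n + 1)) → Set (EuclideanSpace ℝ (Fin (n + 1))))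
    (hNo : ∀ x, IsOpen (N x)) (hN : ∀ x ∈ T, x ∈ N x) :
    ∃ g : EuclideanSpace ℝ (Fin (n + 1)) ≃ₜ EuclideanSpace ℝ (Fin (n + 1)),
      (∀ y, g y = y ∨ ∃ x ∈ T, y ∈ N x ∧ g y ∈ N x) ∧ ∀ x ∈ T, g x ∈ D := by
  obtain ⟨φ, hφ⟩ := htame
  have hTd' : IsTotallyDisconnected (φ '' T) :=
    φ.isEmbedding.isTotallyDisconnected_image.2 hTd
  obtain ⟨g, hg1, hg2⟩ := exists_push_of_subset_coordLine (hT.image φ.continuous) hTd' hφ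
    (hDo.preimage φ.symm.continuous) (hDd.preimage φ.symm.isOpenMap)
    (fun x => φ.symm ⁻¹' N (φ.symm x)) (fun x => (hNo _).preimage φ.symm.continuous)
    (by rintro _ ⟨x, hx, rfl⟩; simpa using hN x hx)
  refine ⟨(φ.trans g).trans φ.symm, fun y => ?_, fun x hx => hg2 _ (mem_image_of_mem φ hx)⟩
  rcases hg1 (φ y) with h | ⟨_, ⟨x, hx, rfl⟩, h1, h2⟩
  · left
    simp [h]
  · right
    refine ⟨x, hx, by simpa using h1, by simpa using h2⟩

/-- The condition that two continuous observables differ at all points of a compact set is open in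
the parameter. -/
theorem isOpen_setOf_forall_ne {X Y Z : Type*} [TopologicalSpace X] [TopologicalSpace Y]
    [TopologicalSpace Z] [T2Space Z] {C : Set X} (hC : IsCompact C) {F G : Y × X → Z}
    (hF : Continuous F) (hG : Continuous G) :
    IsOpen {h : Y | ∀ x ∈ C, F (h, x) ≠ G (h, x)} := by
  rw [isOpen_iff_mem_nhds]
  intro h hh
  exact hC.eventually_forall_of_forall_eventually
    (P := fun h x => F (h, x) ≠ G (h, x)) fun x hx => (isOpen_ne_fun hF hG).mem_nhds (hh x hx)

open scoped BoundedContinuousFunction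

/-- The self-homeomorphisms of `E` at bounded distance from the identity, given by the displacement
of the map and of its inverse. -/
def BoundedHomeo (E : Type*) [NormedAddCommGroup E] : Type _ :=
  {p : (E →ᵇ E) × (E →ᵇ E) // (∀ x, x + p.2 x + p.1 (x + p.2 x) = x) ∧
    ∀ x, x + p.1 x + p.2 (x + p.1 x) = x}

namespace BoundedHomeo

variable {E : Type*} [NormedAddCommGroup E]

instance : MetricSpace (BoundedHomeo E) := Subtype.metricSpace

instance : Nonempty (BoundedHomeo E) := ⟨⟨(0, 0), by simp, by simp⟩⟩

/-- The homeomorphism underlying an element of `BoundedHomeo E`. -/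
def toHomeo (h : BoundedHomeo E) : E ≃ₜ E where
  toFun x := x + h.1.1 x
  invFun x := x + h.1.2 x
  left_inv := h.2.2
  right_inv := h.2.1
  continuous_toFun := continuous_id.add h.1.1.continuous
  continuous_invFun := continuous_id.add h.1.2.continuous

theorem toHomeo_apply (h : BoundedHomeo E) (x : E) : h.toHomeo x = x + h.1.1 x := rfl

theorem toHomeo_symm_apply (h : BoundedHomeo E) (x : E) : h.toHomeo.symm x = x + h.1.2 x := rfl

theorem continuous_toHomeo : Continuous fun q : BoundedHomeo E × E => q.1.toHomeo q.2 := by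
  have h : Continuous fun q : BoundedHomeo E × E => (q.1.1.1, q.2) :=
    ((continuous_fst.comp continuous_subtype_val).comp continuous_fst).prodMk continuous_snd
  exact continuous_snd.add (continuous_eval.comp h)

instance [CompleteSpace E] : CompleteSpace (BoundedHomeo E) := by
  suffices h : IsClosed {p : (E →ᵇ E) × (E →ᵇ E) |
      (∀ x, x + p.2 x + p.1 (x + p.2 x) = x) ∧ ∀ x, x + p.1 x + p.2 (x + p.1 x) = x} from
    h.completeSpace_coe
  have hev : ∀ {F : (E →ᵇ E) × (E →ᵇ E) → (E →ᵇ E)} {u : (E →ᵇ E) × (E →ᵇ E) → E},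
      Continuous F → Continuous u → Continuous fun p => F p (u p) := fun hF hu =>
    continuous_eval.comp (hF.prodMk hu)
  have h1 : ∀ x : E, Continuous fun p : (E →ᵇ E) × (E →ᵇ E) => x + p.1 x := fun x =>
    continuous_const.add (hev continuous_fst continuous_const)
  have h2 : ∀ x : E, Continuous fun p : (E →ᵇ E) × (E →ᵇ E) => x + p.2 x := fun x =>
    continuous_const.add (hev continuous_snd continuous_const)
  rw [ofPred_and, ofPred_forall, ofPred_forall]
  exact (isClosed_iInter fun x =>
      isClosed_eq ((h2 x).add (hev continuous_fst (h2 x))) continuous_const).inter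
    (isClosed_iInter fun x =>
      isClosed_eq ((h1 x).add (hev continuous_snd (h1 x))) continuous_const)

/-- Precomposition with a homeomorphism which is close to the identity. -/
theorem exists_comp (h : BoundedHomeo E) (g : E ≃ₜ E) {ε : ℝ} (hε : 0 ≤ ε)
    (hg : ∀ y, dist (g y) y ≤ ε) (hhg : ∀ y, dist (h.toHomeo (g y)) (h.toHomeo y) ≤ ε) :
    ∃ h' : BoundedHomeo E, dist h' h ≤ ε ∧ ∀ x, h'.toHomeo x = h.toHomeo (g x) := by
  have ha : ∀ x, dist (h.toHomeo (g x) - x) (h.1.1 x) ≤ ε := fun x => by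
    have : h.toHomeo (g x) - x - h.1.1 x = h.toHomeo (g x) - h.toHomeo x := by
      rw [h.toHomeo_apply x]; abel
    rw [dist_eq_norm, this, ← dist_eq_norm]
    exact hhg x
  have hb : ∀ x, dist (g.symm (h.toHomeo.symm x) - x) (h.1.2 x) ≤ ε := fun x => by
    have : g.symm (h.toHomeo.symm x) - x - h.1.2 x
        = g.symm (h.toHomeo.symm x) - h.toHomeo.symm x := by
      rw [h.toHomeo_symm_apply x]; abel
    rw [dist_eq_norm, this, ← dist_eq_norm, dist_comm]
    simpa using hg (g.symm (h.toHomeo.symm x))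
  have hbdd : ∀ {f : E → E} {k : E →ᵇ E}, (∀ x, dist (f x) (k x) ≤ ε) →
      ∀ x, ‖f x‖ ≤ ε + ‖k‖ := fun {f k} H x => by
    have h1 := norm_sub_norm_le (f x) (k x)
    have h2 := k.norm_coe_le_norm x
    have h3 := H x
    rw [dist_eq_norm] at h3
    linarith
  let a : E →ᵇ E := BoundedContinuousFunction.ofNormedAddCommGroup
    (fun x => h.toHomeo (g x) - x)
    ((h.toHomeo.continuous.comp g.continuous).sub continuous_id) _ (hbdd ha)
  let b : E →ᵇ E := BoundedContinuousFunction.ofNormedAddCommGroup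
    (fun x => g.symm (h.toHomeo.symm x) - x)
    ((g.symm.continuous.comp h.toHomeo.symm.continuous).sub continuous_id) _ (hbdd hb)
  have hax : ∀ x, x + a x = h.toHomeo (g x) := fun x => add_sub_cancel _ _
  have hbx : ∀ x, x + b x = g.symm (h.toHomeo.symm x) := fun x => add_sub_cancel _ _
  refine ⟨⟨(a, b), fun x => ?_, fun x => ?_⟩, ?_, hax⟩
  · change x + b x + a (x + b x) = x
    rw [hax, hbx]
    simp
  · change x + a x + b (x + a x) = x
    rw [hbx, hax]
    simp
  · change max (dist a h.1.1) (dist b h.1.2) ≤ ε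
    exact max_le ((BoundedContinuousFunction.dist_le hε).2 ha)
      ((BoundedContinuousFunction.dist_le hε).2 hb)

/-- Within any distance of `h` there is a bounded homeomorphism moving the tame set `T` into the
preimage of a given dense open set, and agreeing with `h` on a closed set disjoint from `T`. -/
theorem exists_push {n : ℕ} {T A D : Set (EuclideanSpace ℝ (Fin (n + 1)))}
    (htame : TameSet T) (hT : IsCompact T) (hTd : IsTotallyDisconnected T)
    (hA : IsClosed A) (hAT : Disjoint A T) (hDo : IsOpen D) (hDd : Dense D)
    (h : BoundedHomeo (EuclideanSpace ℝ (Fin (n + 1)))) {ε : ℝ} (hε : 0 < ε) :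
    ∃ h' : BoundedHomeo (EuclideanSpace ℝ (Fin (n + 1))), dist h' h ≤ ε ∧
      (∀ x ∈ T, h'.toHomeo x ∈ D) ∧ ∀ x ∈ A, h'.toHomeo x = h.toHomeo x := by
  obtain ⟨g, hg1, hg2⟩ := htame.exists_push hT hTd (hDo.preimage h.toHomeo.continuous)
    (hDd.preimage h.toHomeo.isOpenMap)
    (fun x => ball x (ε / 2) ∩ h.toHomeo ⁻¹' ball (h.toHomeo x) (ε / 2) ∩ Aᶜ)
    (fun x => (isOpen_ball.inter (isOpen_ball.preimage h.toHomeo.continuous)).inter hA.isOpen_compl)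
    (fun x hx => ⟨⟨mem_ball_self (half_pos hε), mem_preimage.2 (mem_ball_self (half_pos hε))⟩,
      fun hxA => hAT.le_bot ⟨hxA, hx⟩⟩)
  obtain ⟨h', h1, h2⟩ := h.exists_comp g hε.le
    (fun y => by
      rcases hg1 y with hy | ⟨x, -, hy, hgy⟩
      · simpa [hy] using hε.le
      · linarith [dist_triangle_right (g y) y x, mem_ball.1 hy.1.1, mem_ball.1 hgy.1.1])
    (fun y => by
      rcases hg1 y with hy | ⟨x, -, hy, hgy⟩
      · simpa [hy] using hε.le
      · linarith [dist_triangle_right (h.toHomeo (g y)) (h.toHomeo y) (h.toHomeo x),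
          mem_ball.1 (mem_preimage.1 hy.1.2), mem_ball.1 (mem_preimage.1 hgy.1.2)])
  refine ⟨h', h1, fun x hx => ?_, fun x hx => ?_⟩
  · rw [h2]
    exact hg2 x hx
  · rw [h2]
    rcases hg1 x with hy | ⟨z, -, hy, -⟩
    · rw [hy]
    · exact absurd hx hy.2

end BoundedHomeo

/-- The slab over a dense set of first coordinates is dense. -/
theorem dense_setOf_apply_zero_mem {n : ℕ} {C : Set ℝ} (hC : Dense C) :
    Dense {z : EuclideanSpace ℝ (Fin (n + 1)) | z 0 ∈ C} := by
  have hsurj : Function.Surjective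
      (EuclideanSpace.proj 0 : EuclideanSpace ℝ (Fin (n + 1)) →L[ℝ] ℝ) :=
    fun t => ⟨EuclideanSpace.single 0 t, by simp⟩
  exact hC.preimage (ContinuousLinearMap.isOpenMap _ hsurj)

namespace BoundedHomeo

theorem continuous_toHomeo_apply_zero {n : ℕ} {Y : Type*} [TopologicalSpace Y]
    {u : Y → BoundedHomeo (EuclideanSpace ℝ (Fin (n + 1)))}
    {v : Y → EuclideanSpace ℝ (Fin (n + 1))} (hu : Continuous u) (hv : Continuous v) :
    Continuous fun y => (u y).toHomeo (v y) 0 :=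
  (EuclideanSpace.proj 0 : EuclideanSpace ℝ (Fin (n + 1)) →L[ℝ] ℝ).continuous.comp
    (continuous_toHomeo.comp (hu.prodMk hv))

theorem isOpen_separating {n : ℕ} {A B : Set (EuclideanSpace ℝ (Fin (n + 1)))} (hA : IsCompact A)
    (hB : IsCompact B) :
    IsOpen {h : BoundedHomeo (EuclideanSpace ℝ (Fin (n + 1))) |
      ∀ p ∈ A ×ˢ B, h.toHomeo p.1 0 ≠ h.toHomeo p.2 0} :=
  isOpen_setOf_forall_ne (hA.prod hB)
    (continuous_toHomeo_apply_zero continuous_fst (continuous_fst.comp continuous_snd))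
    (continuous_toHomeo_apply_zero continuous_fst (continuous_snd.comp continuous_snd))

/-- Generically, the first coordinate takes no rational value on a tame compact set. -/
theorem dense_forall_ne_rat {n : ℕ} {A : Set (EuclideanSpace ℝ (Fin (n + 1)))}
    (htame : TameSet A) (hA : IsCompact A) (hAd : IsTotallyDisconnected A) :
    Dense {h : BoundedHomeo (EuclideanSpace ℝ (Fin (n + 1))) |
      ∀ q : ℚ, ∀ x ∈ A, h.toHomeo x 0 ≠ q} := by
  rw [ofPred_forall]
  refine dense_iInter_of_isOpen (fun q => ?_) fun q => ?_
  · exact isOpen_setOf_forall_ne hA (continuous_toHomeo_apply_zero continuous_fst continuous_snd)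
      continuous_const
  · refine Metric.dense_iff.2 fun h ε hε => ?_
    obtain ⟨h', h1, h2, -⟩ := h.exists_push htame hA hAd isClosed_empty (empty_disjoint _)
      (D := {z | z 0 ∈ ({(q : ℝ)}ᶜ : Set ℝ)})
      (isOpen_compl_singleton.preimage
        (EuclideanSpace.proj 0 : EuclideanSpace ℝ (Fin (n + 1)) →L[ℝ] ℝ).continuous)
      (dense_setOf_apply_zero_mem (dense_compl_singleton _)) (half_pos hε)
    exact ⟨h', h1.trans_lt (half_lt_self hε), h2⟩

/-- Generically, the first coordinate separates two disjoint tame compact sets. -/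
theorem dense_separating {n : ℕ} {A B : Set (EuclideanSpace ℝ (Fin (n + 1)))}
    (hAt : TameSet A) (hBt : TameSet B) (hA : IsCompact A) (hB : IsCompact B)
    (hAd : IsTotallyDisconnected A) (hBd : IsTotallyDisconnected B) (hAB : Disjoint A B) :
    Dense {h : BoundedHomeo (EuclideanSpace ℝ (Fin (n + 1))) |
      ∀ p ∈ A ×ˢ B, h.toHomeo p.1 0 ≠ h.toHomeo p.2 0} := by
  refine Metric.dense_iff.2 fun h ε hε => ?_
  obtain ⟨h₁, hh₁, hrat⟩ := Metric.dense_iff.1 (dense_forall_ne_rat hAt hA hAd) h (ε / 2)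
    (half_pos hε)
  set C : Set ℝ := (fun x => h₁.toHomeo x 0) '' A with hC
  have hCc : IsCompact C :=
    hA.image (continuous_toHomeo_apply_zero continuous_const continuous_id)
  have hCd : Dense Cᶜ := Rat.denseRange_cast.mono <| by
    rintro _ ⟨q, rfl⟩ ⟨x, hx, hxq⟩
    exact hrat q x hx hxq
  obtain ⟨h', h1, h2, h3⟩ := h₁.exists_push hBt hB hBd hA.isClosed hAB
    (D := {z | z 0 ∈ Cᶜ})
    (hCc.isClosed.isOpen_compl.preimage
      (EuclideanSpace.proj 0 : EuclideanSpace ℝ (Fin (n + 1)) →L[ℝ] ℝ).continuous)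
    (dense_setOf_apply_zero_mem hCd) (show 0 < ε / 3 by positivity)
  refine ⟨h', ?_, fun p hp heq => h2 p.2 hp.2 ⟨p.1, hp.1, ?_⟩⟩
  · rw [mem_ball] at hh₁ ⊢
    linarith [dist_triangle h' h₁ h]
  · simp only
    rw [← h3 p.1 hp.1, heq]

end BoundedHomeo

theorem TameSet.mono {n : ℕ} {A B : Set (EuclideanSpace ℝ (Fin n))} (hB : TameSet B)
    (hAB : A ⊆ B) : TameSet A :=
  let ⟨h, hh⟩ := hB
  ⟨h, (image_mono hAB).trans hh⟩

/-- The image of a tame set under a homeomorphism pulls back to a tame set. -/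
theorem TameSet.of_image {n : ℕ} {K : Set (EuclideanSpace ℝ (Fin n))}
    (h : EuclideanSpace ℝ (Fin n) ≃ₜ EuclideanSpace ℝ (Fin n)) (hK : TameSet (h '' K)) :
    TameSet K := by
  obtain ⟨g, hg⟩ := hK
  refine ⟨h.trans g, ?_⟩
  change (g ∘ h) '' K ⊆ coordLine n
  rwa [image_comp]

/-- A compact set on which the first coordinate is injective is tame. -/
theorem tameSet_of_injOn_apply_zero {n : ℕ} {K : Set (EuclideanSpace ℝ (Fin (n + 1)))}
    (hK : IsCompact K) (hinj : InjOn (fun x : EuclideanSpace ℝ (Fin (n + 1)) => x 0) K) :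
    TameSet K := by
  have : CompactSpace K := isCompact_iff_compactSpace.1 hK
  have hc0 : Continuous fun x : EuclideanSpace ℝ (Fin (n + 1)) => x 0 :=
    (EuclideanSpace.proj 0 : EuclideanSpace ℝ (Fin (n + 1)) →L[ℝ] ℝ).continuous
  have hemb : IsClosedEmbedding fun x : K => (x : EuclideanSpace ℝ (Fin (n + 1))) 0 :=
    (hc0.comp continuous_subtype_val).isClosedEmbedding (injOn_iff_injective.1 hinj)
  obtain ⟨F, hF⟩ := ContinuousMap.exists_extension' hemb
    (⟨Subtype.val, continuous_subtype_val⟩ : C(K, EuclideanSpace ℝ (Fin (n + 1))))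
  have hFK : ∀ x ∈ K, F (x 0) = x := fun x hx => congrFun hF ⟨x, hx⟩
  set G : ℝ → EuclideanSpace ℝ (Fin (n + 1)) :=
    fun t => F t - EuclideanSpace.single 0 (F t 0) with hG
  have hG0 : ∀ t, G t 0 = 0 := fun t => by simp [hG]
  have hsingle : Continuous fun t : ℝ => (EuclideanSpace.single 0 t :
      EuclideanSpace ℝ (Fin (n + 1))) :=
    (Isometry.of_dist_eq fun s t => PiLp.dist_single_same _ _ _ _ _).continuous
  have hGc : Continuous G := F.continuous.sub
    (hsingle.comp (hc0.comp F.continuous))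
  let Φ : EuclideanSpace ℝ (Fin (n + 1)) ≃ₜ EuclideanSpace ℝ (Fin (n + 1)) :=
    { toFun := fun z => z - G (z 0)
      invFun := fun z => z + G (z 0)
      left_inv := fun z => by simp [hG0]
      right_inv := fun z => by simp [hG0]
      continuous_toFun := continuous_id.sub (hGc.comp hc0)
      continuous_invFun := continuous_id.add (hGc.comp hc0) }
  refine ⟨Φ, ?_⟩
  rintro _ ⟨x, hx, rfl⟩ i hi
  have hi₀ : i ≠ 0 := fun h => hi (by simp [h])
  change (x - G (x 0)) i = 0
  simp [hG, hFK x hx, hi₀]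

/-- Two distinct points are separated by a thick sphere from a countable family. -/
theorem exists_denseSeq_separating {X : Type*} [MetricSpace X] [TopologicalSpace.SeparableSpace X]
    [Nonempty X] {x y : X} (hxy : x ≠ y) :
    ∃ k m : ℕ, dist x (TopologicalSpace.denseSeq X k) ≤ 1 / ((m : ℝ) + 1) ∧
      2 / ((m : ℝ) + 1) ≤ dist y (TopologicalSpace.denseSeq X k) := by
  obtain ⟨m, hm⟩ := exists_nat_one_div_lt (show 0 < dist x y / 3 by
    have := dist_pos.2 hxy
    positivity)
  obtain ⟨k, hk⟩ := (TopologicalSpace.denseRange_denseSeq X).exists_dist_lt x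
    (Nat.one_div_pos_of_nat (α := ℝ) (n := m))
  refine ⟨k, m, hk.le, ?_⟩
  have h1 := dist_triangle_right x y (TopologicalSpace.denseSeq X k)
  rw [show (2 : ℝ) / ((m : ℝ) + 1) = 2 * (1 / ((m : ℝ) + 1)) by ring]
  linarith

/-- A compact totally disconnected countable union of tame compact sets is tame. -/
theorem tameSet_iUnion_of_isCompact {n : ℕ} {Ks : ℕ → Set (EuclideanSpace ℝ (Fin (n + 1)))}
    (hcpt : ∀ i, IsCompact (Ks i)) (htame : ∀ i, TameSet (Ks i))
    (hK : IsCompact (⋃ i, Ks i)) (hKd : IsTotallyDisconnected (⋃ i, Ks i)) :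
    TameSet (⋃ i, Ks i) := by
  set d := TopologicalSpace.denseSeq (EuclideanSpace ℝ (Fin (n + 1)))
  let P : ℕ → ℕ → Set (EuclideanSpace ℝ (Fin (n + 1))) :=
    fun k m => {z | dist z (d k) ≤ 1 / ((m : ℝ) + 1)}
  let Q : ℕ → ℕ → Set (EuclideanSpace ℝ (Fin (n + 1))) :=
    fun k m => {z | 2 / ((m : ℝ) + 1) ≤ dist z (d k)}
  have hdc : ∀ k, Continuous fun z => dist z (d k) := fun k => continuous_id.dist continuous_const
  have hP : ∀ k m, IsClosed (P k m) := fun k m => isClosed_le (hdc k) continuous_const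
  have hQ : ∀ k m, IsClosed (Q k m) := fun k m => isClosed_le continuous_const (hdc k)
  have hPQ : ∀ k m, Disjoint (P k m) (Q k m) := fun k m => by
    rw [Set.disjoint_left]
    intro z (h1 : dist z (d k) ≤ 1 / ((m : ℝ) + 1)) (h2 : 2 / ((m : ℝ) + 1) ≤ dist z (d k))
    have h3 : (0 : ℝ) < 1 / ((m : ℝ) + 1) := Nat.one_div_pos_of_nat
    rw [show (2 : ℝ) / ((m : ℝ) + 1) = 2 * (1 / ((m : ℝ) + 1)) by ring] at h2
    linarith
  have hd : ∀ i (S : Set (EuclideanSpace ℝ (Fin (n + 1)))), IsTotallyDisconnected (Ks i ∩ S) :=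
    fun i S t ht => hKd t (ht.trans (inter_subset_left.trans (subset_iUnion Ks i)))
  have hdense := dense_iInter_of_isOpen (ι := (ℕ × ℕ) × ℕ × ℕ)
    (f := fun a => {h : BoundedHomeo (EuclideanSpace ℝ (Fin (n + 1))) |
      ∀ p ∈ (Ks a.1.1 ∩ P a.2.1 a.2.2) ×ˢ (Ks a.1.2 ∩ Q a.2.1 a.2.2),
        h.toHomeo p.1 0 ≠ h.toHomeo p.2 0})
    (fun a => BoundedHomeo.isOpen_separating ((hcpt _).inter_right (hP _ _))
      ((hcpt _).inter_right (hQ _ _)))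
    (fun a => BoundedHomeo.dense_separating ((htame _).mono inter_subset_left)
      ((htame _).mono inter_subset_left) ((hcpt _).inter_right (hP _ _))
      ((hcpt _).inter_right (hQ _ _)) (hd _ _) (hd _ _)
      ((hPQ _ _).mono inter_subset_right inter_subset_right))
  obtain ⟨h, hh⟩ := hdense.nonempty
  rw [mem_iInter] at hh
  refine TameSet.of_image h.toHomeo
    (tameSet_of_injOn_apply_zero (hK.image h.toHomeo.continuous) ?_)
  rintro _ ⟨x, hx, rfl⟩ _ ⟨y, hy, rfl⟩ heq
  by_contra hne
  obtain ⟨k, m, hkx, hky⟩ := exists_denseSeq_separating fun hxy : x = y => hne (by rw [hxy])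
  obtain ⟨i, hi⟩ := mem_iUnion.1 hx
  obtain ⟨j, hj⟩ := mem_iUnion.1 hy
  exact hh ((i, j), k, m) (x, y) ⟨⟨hi, hkx⟩, ⟨hj, hky⟩⟩ heq

theorem IsCantorSet.isCompact {X : Type*} [TopologicalSpace X] {K : Set X} (hK : IsCantorSet K) :
    IsCompact K := by
  obtain ⟨e⟩ := hK
  have : CompactSpace cantorSet := isCompact_iff_compactSpace.1 isCompact_cantorSet
  exact isCompact_iff_compactSpace.2 e.symm.compactSpace

theorem IsCantorSet.isTotallyDisconnected {X : Type*} [TopologicalSpace X] {K : Set X}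
    (hK : IsCantorSet K) : IsTotallyDisconnected K := by
  obtain ⟨e⟩ := hK
  have : TotallyDisconnectedSpace K := by
    let e' : K ≃ₜ (ℕ → Bool) := e.trans cantorSetHomeomorphNatToBool
    exact ⟨e'.isEmbedding.isTotallyDisconnected
      (isTotallyDisconnected_of_totallyDisconnectedSpace _)⟩
  exact totallyDisconnectedSpace_subtype_iff.1 this

/-- **Statement 2.7 (Frolkina, after Osborne/Bing).** A Cantor set in `ℝⁿ` which is a union
of countably many tame compact sets is tame. -/
theorem tame_of_countable_union_tame (n : ℕ) (K : Set (EuclideanSpace ℝ (Fin n)))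
    (hK : IsCantorSet K) (Ks : ℕ → Set (EuclideanSpace ℝ (Fin n)))
    (hcpt : ∀ i, IsCompact (Ks i)) (htame : ∀ i, TameSet (Ks i))
    (hunion : K = ⋃ i, Ks i) :
    TameSet K := by
  cases n with
  | zero => exact ⟨Homeomorph.refl _, fun x _ i => i.elim0⟩
  | succ n =>
    subst hunion
    exact tameSet_iUnion_of_isCompact hcpt htame hK.isCompact hK.isTotallyDisconnected

end
end

section
/- For every n ≥ 2, every compact totally disconnected set K contained in the hyperplane ℝ^{n−1} × {0} ⊆ ℝⁿ is tame in ℝⁿ: there exists a homeomorphism h of ℝⁿ onto itself such that h(K) is contained in the coordinate line ℝ × {0}^{n−1}. -/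
open Set Topology Metric

noncomputable section

/-- A compact, totally disconnected, second countable space admits a continuous injection into
the Cantor set, hence into `ℝ`. -/
theorem exists_continuous_injective_real (X : Type*) [TopologicalSpace X] [CompactSpace X]
    [T2Space X] [TotallyDisconnectedSpace X] [SecondCountableTopology X] :
    ∃ f : X → ℝ, Continuous f ∧ Function.Injective f := by
  classical
  have : Countable (TopologicalSpace.Clopens X) :=
    TopologicalSpace.Clopens.countable_iff_secondCountable.2 inferInstance
  obtain ⟨u, hu⟩ := exists_surjective_nat (TopologicalSpace.Clopens X)
  let b : X → ℕ → Bool := fun x i => decide (x ∈ u i)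
  have hb : Continuous b := continuous_pi fun i =>
    (IsLocallyConstant.iff_continuous _).1 <| (IsLocallyConstant.iff_exists_open _).2 fun x => by
      by_cases hx : x ∈ u i
      · exact ⟨u i, (u i).isClopen.isOpen, hx, fun y hy => by
          simp [b, hx, show y ∈ u i from hy]⟩
      · exact ⟨(u i : Set X)ᶜ, (u i).isClopen.compl.isOpen, hx, fun y hy => by
          simp [b, hx, show y ∉ u i from hy]⟩
  have hinj : Function.Injective b := by
    intro x y hxy
    by_contra hne
    obtain ⟨U, hU, hxU, hyU⟩ := exists_isClopen_of_totally_separated hne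
    obtain ⟨i, hi⟩ := hu ⟨U, hU⟩
    have h := congrFun hxy i
    have hxi : x ∈ u i := hi ▸ hxU
    have hyi : y ∉ u i := hi ▸ hyU
    simp [b, hxi, hyi] at h
  exact ⟨fun x => (cantorSetHomeomorphNatToBool.symm (b x) : ℝ),
    continuous_subtype_val.comp (cantorSetHomeomorphNatToBool.symm.continuous.comp hb),
    Subtype.val_injective.comp (cantorSetHomeomorphNatToBool.symm.injective.comp hinj)⟩

/-- Translation of each fibre of `q` by a vector depending continuously on the value of `q`,
assuming that such translations preserve the fibres. -/
def fibreShear {E Y : Type*} [TopologicalSpace E] [AddCommGroup E] [IsTopologicalAddGroup E]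
    [TopologicalSpace Y] (q : E → Y) (hq : Continuous q) (v : Y → E) (hv : Continuous v)
    (hadd : ∀ x y, q (x + v y) = q x) : E ≃ₜ E where
  toFun x := x + v (q x)
  invFun x := x - v (q x)
  left_inv x := by simp [hadd]
  right_inv x := by
    have h : q (x - v (q x)) = q x := by simpa using (hadd (x - v (q x)) (q x)).symm
    simp [h]
  continuous_toFun := by fun_prop
  continuous_invFun := by fun_prop

/-- A compact totally disconnected subset of the hyperplane `ℝ^{n-1} × {0} ⊆ ℝⁿ` is tame
in `ℝⁿ`. -/
theorem tame_of_subset_hyperplane (n : ℕ) (hn : 2 ≤ n)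
    (K : Set (EuclideanSpace ℝ (Fin n))) (hcpt : IsCompact K)
    (htd : IsTotallyDisconnected K) (hsub : K ⊆ coordHyperplane n) :
    TameSet K := by
  have : CompactSpace K := isCompact_iff_compactSpace.1 hcpt
  have : TotallyDisconnectedSpace K := totallyDisconnectedSpace_subtype_iff.2 htd
  obtain ⟨f, hf, hfinj⟩ := exists_continuous_injective_real K
  obtain ⟨F, hF⟩ := ContinuousMap.exists_extension' hcpt.isClosed.isClosedEmbedding_subtypeVal
    ⟨f, hf⟩
  obtain ⟨G, hG⟩ := ContinuousMap.exists_extension' (hf.isClosedEmbedding hfinj)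
    (⟨fun x i => (x : EuclideanSpace ℝ (Fin n)) i, by fun_prop⟩ : C(K, Fin n → ℝ))
  let z : Fin n := ⟨0, by omega⟩
  let l : Fin n := ⟨n - 1, by omega⟩
  let e : EuclideanSpace ℝ (Fin n) := EuclideanSpace.single l 1
  let P : EuclideanSpace ℝ (Fin n) → EuclideanSpace ℝ (Fin n) := fun x => x - x l • e
  have hP : Continuous P := by fun_prop
  have hPK : ∀ x ∈ K, P x = x := fun x hx => by simp [P, hsub hx l rfl]
  let h₁ : EuclideanSpace ℝ (Fin n) ≃ₜ EuclideanSpace ℝ (Fin n) :=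
    fibreShear P hP (fun x => F x • e) (by fun_prop) fun x y => by
      simp [P, e, add_smul]
  let h₂ : EuclideanSpace ℝ (Fin n) ≃ₜ EuclideanSpace ℝ (Fin n) :=
    fibreShear (fun x => x l) (by fun_prop) (fun t => -P (WithLp.toLp 2 (G t))) (by fun_prop)
      fun x y => by simp [P, e]
  let σ := LinearIsometryEquiv.piLpCongrLeft 2 ℝ ℝ (Equiv.swap z l)
  refine ⟨(h₁.trans h₂).trans σ.toHomeomorph, ?_⟩
  rintro _ ⟨x, hx, rfl⟩ i hi
  have hFx : F x = f ⟨x, hx⟩ := congrFun hF ⟨x, hx⟩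
  have hGx : WithLp.toLp 2 (G (f ⟨x, hx⟩)) = x := by
    ext j
    exact congrFun (congrFun hG ⟨x, hx⟩) j
  have hh₁ : h₁ x = x + f ⟨x, hx⟩ • e := by
    simp [h₁, fibreShear, hPK x hx, hFx]
  have hh₂ : h₂ (h₁ x) = EuclideanSpace.single l (f ⟨x, hx⟩) := by
    have hl : (x + f ⟨x, hx⟩ • e) l = f ⟨x, hx⟩ := by simp [e, hsub hx l rfl]
    rw [hh₁]
    change x + f ⟨x, hx⟩ • e + -P (WithLp.toLp 2 (G ((x + f ⟨x, hx⟩ • e) l))) = _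
    rw [hl, hGx, hPK x hx]
    ext j
    simp [e]
  change σ (h₂ (h₁ x)) i = 0
  have hiz : i ≠ z := fun h => hi (congrArg Fin.val h)
  rw [hh₂, EuclideanSpace.piLpCongrLeft_single, Equiv.swap_apply_right]
  simp [hiz]

end
end
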